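/- If G is a graph in obs(P1) that is not isomorphic to any of the 33 graphs in O, then G has at most one cut-vertex. -/

import Mathlib

open SimpleGraph

/-- `H` is a minor of `G` (branch-set definition): there is a family of connected, nonempty,
pairwise disjoint branch sets in `G`, indexed by the vertices of `H`, such that vertices
adjacent in `H` have an edge of `G` between their branch sets. -/
def IsMinorOf {W V : Type} (H : SimpleGraph W) (G : SimpleGraph V) : Prop :=
  ∃ f : W → Set V,
    (∀ w, (G.induce (f w)).Connected) ∧
    (∀ ⦃w w' : W⦄, w ≠ w' → Disjoint (f w) (f w')) ∧
    (∀ ⦃w w' : W⦄, H.Adj w w' → ∃ a ∈ f w, ∃ b ∈ f w', G.Adj a b)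

/-- A pseudoforest: every connected component contains at most one cycle, i.e. any two
cycles lying in the same connected component have the same edge set. -/
def Pseudoforest {V : Type} (G : SimpleGraph V) : Prop :=
  ∀ ⦃u v : V⦄ (c : G.Walk u u) (c' : G.Walk v v),
    c.IsCycle → c'.IsCycle → G.Reachable u v → ∀ e, e ∈ c.edges ↔ e ∈ c'.edges

/-- An apex-pseudoforest: removing at most one vertex yields a pseudoforest. -/
def ApexPseudoforest {V : Type} (G : SimpleGraph V) : Prop :=
  ∃ s : Set V, s.Subsingleton ∧ Pseudoforest (G.induce sᶜ)

/-- `G` is a minor-obstruction for the class of apex-pseudoforests: `G` is not an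
apex-pseudoforest but every proper minor of `G` is. -/
def ObsApexPseudoforest {V : Type} (G : SimpleGraph V) : Prop :=
  ¬ ApexPseudoforest G ∧
    ∀ (W : Type) [Finite W] (H : SimpleGraph W),
      IsMinorOf H G → IsEmpty (H ≃g G) → ApexPseudoforest H

/-- The simple graph on `Fin n` with the given list of (0-indexed) edges. -/
def mkGraph (n : ℕ) (E : List (ℕ × ℕ)) : SimpleGraph (Fin n) :=
  SimpleGraph.fromRel fun a b => ((a : ℕ), (b : ℕ)) ∈ E

/-- Obstruction 1: two disjoint diamonds. -/
def O1 : SimpleGraph (Fin 8) :=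
  mkGraph 8 [(0,1),(0,2),(0,3),(1,2),(1,3),(4,5),(4,6),(4,7),(5,6),(5,7)]
/-- Obstruction 2: two disjoint butterflies. -/
def O2 : SimpleGraph (Fin 10) :=
  mkGraph 10 [(0,1),(0,2),(1,2),(0,3),(0,4),(3,4),(5,6),(5,7),(6,7),(5,8),(5,9),(8,9)]
/-- Obstruction 3: a diamond plus a butterfly. -/
def O3 : SimpleGraph (Fin 9) :=
  mkGraph 9 [(0,1),(0,2),(0,3),(1,2),(1,3),(4,5),(4,6),(5,6),(4,7),(4,8),(7,8)]
def O4 : SimpleGraph (Fin 8) :=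
  mkGraph 8 [(0,1),(0,2),(1,2),(2,3),(2,4),(3,4),(3,5),(4,5),(5,6),(5,7),(6,7)]
def O5 : SimpleGraph (Fin 8) :=
  mkGraph 8 [(0,1),(0,2),(1,2),(2,3),(2,4),(3,4),(3,5),(4,6),(5,6),(5,7),(6,7)]
def O6 : SimpleGraph (Fin 8) :=
  mkGraph 8 [(0,1),(0,2),(1,2),(2,3),(2,4),(3,4),(3,5),(4,5),(3,6),(5,6),(4,7),(5,7)]
def O7 : SimpleGraph (Fin 7) :=
  mkGraph 7 [(0,1),(0,6),(1,6),(2,3),(2,4),(2,5),(3,4),(3,5),(4,6),(5,6)]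
def O8 : SimpleGraph (Fin 7) :=
  mkGraph 7 [(0,1),(0,2),(1,2),(2,3),(2,4),(2,5),(3,4),(3,5),(4,5),(4,6),(5,6)]
def O9 : SimpleGraph (Fin 9) :=
  mkGraph 9 [(0,1),(0,2),(1,2),(2,3),(2,4),(3,4),(3,5),(4,5),(2,6),(4,6),(2,7),(3,7),(3,8),(4,8)]
def O10 : SimpleGraph (Fin 9) :=
  mkGraph 9 [(0,1),(1,2),(2,3),(3,0),(0,4),(1,4),(1,5),(2,5),(2,6),(3,6),(0,7),(0,8),(7,8)]
def O11 : SimpleGraph (Fin 9) :=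
  mkGraph 9 [(0,1),(0,2),(1,2),(3,4),(3,5),(4,5),(6,7),(6,8),(7,8),(2,3),(1,8),(4,8)]
def O12 : SimpleGraph (Fin 9) :=
  mkGraph 9 [(0,1),(0,2),(1,2),(3,4),(3,5),(4,5),(6,7),(6,8),(7,8),(2,3),(2,7),(3,6)]
def O13 : SimpleGraph (Fin 9) :=
  mkGraph 9 [(0,1),(0,2),(1,2),(3,4),(3,5),(4,5),(6,7),(6,8),(7,8),(2,3),(2,8),(3,8)]
def O14 : SimpleGraph (Fin 8) :=
  mkGraph 8 [(0,1),(0,2),(1,2),(1,4),(2,3),(2,4),(3,4),(3,5),(4,5),(1,6),(1,7),(6,7)]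
def O15 : SimpleGraph (Fin 9) :=
  mkGraph 9 [(0,1),(0,2),(1,2),(2,3),(2,4),(3,4),(4,5),(4,6),(5,6),(6,7),(6,8),(7,8),(2,6)]
def O16 : SimpleGraph (Fin 6) :=
  mkGraph 6 [(0,2),(0,3),(0,4),(0,5),(1,2),(1,3),(1,4),(1,5),(2,3),(4,5)]
def O17 : SimpleGraph (Fin 6) :=
  mkGraph 6 [(0,1),(1,3),(3,2),(2,0),(4,0),(4,1),(4,2),(4,3),(5,0),(5,1)]
def O18 : SimpleGraph (Fin 8) :=
  mkGraph 8 [(0,1),(1,2),(2,3),(3,0),(4,0),(4,1),(5,1),(5,2),(6,2),(6,3),(7,3),(7,0)]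
def O19 : SimpleGraph (Fin 7) :=
  mkGraph 7 [(0,2),(0,3),(1,2),(1,3),(2,3),(0,4),(4,1),(5,0),(5,4),(6,4),(6,1)]
def O20 : SimpleGraph (Fin 6) :=
  mkGraph 6 [(1,2),(1,4),(1,5),(2,4),(2,5),(4,5),(0,1),(0,4),(2,3),(3,5)]
def O21 : SimpleGraph (Fin 7) :=
  mkGraph 7 [(0,1),(0,3),(0,4),(1,3),(1,4),(3,5),(4,5),(1,2),(2,4),(3,6),(5,6)]
def O22 : SimpleGraph (Fin 8) :=
  mkGraph 8 [(0,1),(0,3),(1,4),(3,4),(1,2),(2,4),(7,0),(7,3),(5,7),(5,0),(6,7),(6,3)]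
def O23 : SimpleGraph (Fin 7) :=
  mkGraph 7 [(2,3),(2,4),(2,6),(3,4),(3,6),(4,6),(5,3),(5,4),(0,2),(0,3),(1,2),(1,4)]
def O24 : SimpleGraph (Fin 7) :=
  mkGraph 7 [(0,1),(0,2),(1,2),(1,3),(2,4),(3,5),(3,6),(4,5),(4,6),(5,6)]
def O25 : SimpleGraph (Fin 8) :=
  mkGraph 8 [(0,1),(0,3),(1,3),(1,2),(1,5),(2,5),(1,7),(2,7),(3,4),(4,5),(3,5),(3,6),(5,6)]
def O26 : SimpleGraph (Fin 9) :=
  mkGraph 9 [(2,3),(2,4),(3,4),(5,3),(5,4),(8,3),(8,4),(0,2),(0,3),(7,2),(7,3),(1,2),(1,4),(6,2),(6,4)]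
def O27 : SimpleGraph (Fin 8) :=
  mkGraph 8 [(0,2),(1,2),(0,3),(2,3),(1,6),(2,6),(3,4),(6,7),(4,5),(5,7),(3,7),(4,7)]
def O28 : SimpleGraph (Fin 7) :=
  mkGraph 7 [(0,1),(0,2),(1,2),(1,3),(1,5),(3,5),(3,4),(3,6),(4,6),(2,5),(5,6)]
def O29 : SimpleGraph (Fin 9) :=
  mkGraph 9 [(0,1),(0,2),(1,2),(3,4),(3,5),(4,5),(6,7),(6,8),(7,8),(2,3),(1,7),(4,6)]
def O30 : SimpleGraph (Fin 8) :=
  mkGraph 8 [(0,1),(0,2),(1,2),(3,4),(3,5),(4,5),(6,7),(1,6),(4,6),(0,7),(5,7)]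
/-- Obstruction 31: the prism. -/
def O31 : SimpleGraph (Fin 6) :=
  mkGraph 6 [(0,1),(0,2),(1,2),(3,4),(3,5),(4,5),(0,3),(1,4),(2,5)]
/-- Obstruction 32: `K₃,₃`. -/
def O32 : SimpleGraph (Fin 6) :=
  mkGraph 6 [(0,3),(0,4),(0,5),(1,3),(1,4),(1,5),(2,3),(2,4),(2,5)]
/-- Obstruction 33: `K₅` minus one edge. -/
def O33 : SimpleGraph (Fin 5) :=
  mkGraph 5 [(0,1),(0,2),(0,3),(0,4),(1,2),(1,3),(1,4),(2,3),(2,4)]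

/-- The list `O` of the 33 obstructions. -/
def OList : List ((n : ℕ) × SimpleGraph (Fin n)) :=
  [⟨8, O1⟩, ⟨10, O2⟩, ⟨9, O3⟩, ⟨8, O4⟩, ⟨8, O5⟩, ⟨8, O6⟩, ⟨7, O7⟩, ⟨7, O8⟩, ⟨9, O9⟩,
   ⟨9, O10⟩, ⟨9, O11⟩, ⟨9, O12⟩, ⟨9, O13⟩, ⟨8, O14⟩, ⟨9, O15⟩, ⟨6, O16⟩, ⟨6, O17⟩,
   ⟨8, O18⟩, ⟨7, O19⟩, ⟨6, O20⟩, ⟨7, O21⟩, ⟨8, O22⟩, ⟨7, O23⟩, ⟨7, O24⟩, ⟨8, O25⟩,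
   ⟨9, O26⟩, ⟨8, O27⟩, ⟨7, O28⟩, ⟨9, O29⟩, ⟨8, O30⟩, ⟨6, O31⟩, ⟨6, O32⟩, ⟨5, O33⟩]

/-- `G` is isomorphic to one of the 33 graphs in `O`. -/
def InO {V : Type} (G : SimpleGraph V) : Prop :=
  ∃ H ∈ OList, Nonempty (G ≃g H.2)

/-- A cut-vertex: a vertex whose deletion increases the number of connected components. -/
def CutVertex {V : Type} (G : SimpleGraph V) (x : V) : Prop :=
  Nat.card G.ConnectedComponent <
    Nat.card (G.induce ({x}ᶜ : Set V)).ConnectedComponent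

namespace ApexPseudoforestObstruction

variable {V : Type} {G H : SimpleGraph V} {A C M N P Q R S T U W : Set V} {a b u v x y : V}

/-- `a` and `b` are joined by a walk of `G` inside `S`. -/
def ReachIn (G : SimpleGraph V) (S : Set V) (a b : V) : Prop :=
  ∃ p : G.Walk a b, ∀ w ∈ p.support, w ∈ S

/-- `S` induces a connected subgraph of `G`. -/
def ConnSet (G : SimpleGraph V) (S : Set V) : Prop :=
  S.Nonempty ∧ ∀ a ∈ S, ∀ b ∈ S, ReachIn G S a b

/-- The vertices reachable from `a` inside `S`. -/
def comp (G : SimpleGraph V) (S : Set V) (a : V) : Set V := {w | ReachIn G S a w}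

/-- Some edge of `G` joins `S` to `T`. -/
def Touch (G : SimpleGraph V) (S T : Set V) : Prop := ∃ a ∈ S, ∃ b ∈ T, G.Adj a b

/-- Some cycle of `G` lies inside `S`. -/
def HasCycle (G : SimpleGraph V) (S : Set V) : Prop :=
  ∃ u, ∃ c : G.Walk u u, c.IsCycle ∧ ∀ w ∈ c.support, w ∈ S

/-- `S` induces a pseudoforest in `G`. -/
def PseudoforestOn (G : SimpleGraph V) (S : Set V) : Prop :=
  ∀ ⦃u v : V⦄ (c : G.Walk u u) (c' : G.Walk v v), c.IsCycle → c'.IsCycle →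
    (∀ w ∈ c.support, w ∈ S) → (∀ w ∈ c'.support, w ∈ S) → ReachIn G S u v →
    ∀ e, e ∈ c.edges ↔ e ∈ c'.edges

/-! ### Reachability inside a set -/

namespace ReachIn

lemma left_mem (h : ReachIn G S a b) : a ∈ S := h.choose_spec _ (Walk.start_mem_support _)

lemma right_mem (h : ReachIn G S a b) : b ∈ S := h.choose_spec _ (Walk.end_mem_support _)

lemma refl (h : a ∈ S) : ReachIn G S a a := ⟨.nil, by simpa⟩

lemma symm (h : ReachIn G S a b) : ReachIn G S b a := by
  obtain ⟨p, hp⟩ := h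
  exact ⟨p.reverse, by simpa⟩

lemma trans (h : ReachIn G S a b) (h' : ReachIn G S b x) : ReachIn G S a x := by
  obtain ⟨p, hp⟩ := h
  obtain ⟨q, hq⟩ := h'
  exact ⟨p.append q, by grind [Walk.mem_support_append_iff]⟩

lemma mono (h : ReachIn G S a b) (hST : S ⊆ T) : ReachIn G T a b := by
  obtain ⟨p, hp⟩ := h
  exact ⟨p, fun w hw => hST (hp w hw)⟩

lemma of_adj (h : G.Adj a b) (ha : a ∈ S) (hb : b ∈ S) : ReachIn G S a b :=
  ⟨.cons h .nil, by simp [ha, hb]⟩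

/-- A property preserved along edges into `S` is preserved along walks in `S`. -/
lemma invariant (h : ReachIn G S a b) {P : V → Prop} (ha : P a)
    (hP : ∀ u v, P u → u ∈ S → G.Adj u v → v ∈ S → P v) : P b := by
  obtain ⟨p, hp⟩ := h
  induction p with
  | nil => exact ha
  | cons h p ih =>
    simp only [Walk.support_cons, List.mem_cons, forall_eq_or_imp] at hp
    exact ih (hP _ _ ha hp.1 h (hp.2 _ p.start_mem_support)) hp.2

lemma map_graph (h : ReachIn G S a b) (hGH : ∀ u ∈ S, ∀ v ∈ S, G.Adj u v → H.Adj u v) :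
    ReachIn H S a b := by
  refine h.invariant (P := fun w => ReachIn H S a w) (refl h.left_mem) ?_
  intro u v hu hu' huv hv
  exact hu.trans (of_adj (hGH u hu' v hv huv) hu' hv)

lemma of_walk_mem [DecidableEq V] {p : G.Walk u v} (ha : a ∈ p.support) (hb : b ∈ p.support) :
    ReachIn G {w | w ∈ p.support} a b :=
  have key : ∀ w, w ∈ p.support → ReachIn G {w | w ∈ p.support} u w := fun w hw =>
    ⟨p.takeUntil w hw, fun _ h => p.support_takeUntil_subset_support hw h⟩
  (key a ha).symm.trans (key b hb)

end ReachIn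

lemma connSet_iff : ConnSet G S ↔ (G.induce S).Connected := by
  have reach : ∀ {a b : S} (_ : (G.induce S).Walk a b), ReachIn G S a b := by
    intro a b p
    induction p with
    | @nil a => exact .refl a.2
    | @cons a b c h p ih => exact .trans (.of_adj h a.2 b.2) ih
  rw [connected_iff_exists_forall_reachable]
  constructor
  · rintro ⟨⟨a, ha⟩, h⟩
    refine ⟨⟨a, ha⟩, fun ⟨b, hb⟩ => ?_⟩
    obtain ⟨p, hp⟩ := h a ha b hb
    exact ⟨p.induce S hp⟩
  · rintro ⟨⟨a, ha⟩, h⟩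
    have key : ∀ b ∈ S, ReachIn G S a b := by
      intro b hb
      obtain ⟨p⟩ := h ⟨b, hb⟩
      exact reach p
    exact ⟨⟨a, ha⟩, fun b hb c hc => (key b hb).symm.trans (key c hc)⟩

/-! ### Connected sets -/

lemma Touch.symm (h : Touch G S T) : Touch G T S := by
  obtain ⟨a, ha, b, hb, hab⟩ := h
  exact ⟨b, hb, a, ha, hab.symm⟩

lemma Touch.mono {S' T' : Set V} (h : Touch G S T) (hS : S ⊆ S') (hT : T ⊆ T') :
    Touch G S' T' := by
  obtain ⟨a, ha, b, hb, hab⟩ := h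
  exact ⟨a, hS ha, b, hT hb, hab⟩

lemma touch_singletons (h : G.Adj a b) : Touch G {a} {b} := ⟨a, rfl, b, rfl, h⟩

lemma connSet_of_forall (ha : a ∈ S) (h : ∀ b ∈ S, ReachIn G S b a) : ConnSet G S :=
  ⟨⟨a, ha⟩, fun b hb c hc => (h b hb).trans (h c hc).symm⟩

lemma connSet_singleton (a : V) : ConnSet G {a} :=
  connSet_of_forall rfl (by rintro b rfl; exact .refl rfl)

lemma ConnSet.union (hS : ConnSet G S) (hT : ConnSet G T) (h : (S ∩ T).Nonempty) :
    ConnSet G (S ∪ T) := by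
  obtain ⟨a, haS, haT⟩ := h
  refine connSet_of_forall (Or.inl haS) ?_
  rintro b (hb | hb)
  · exact (hS.2 b hb a haS).mono Set.subset_union_left
  · exact (hT.2 b hb a haT).mono Set.subset_union_right

lemma ConnSet.union_of_touch (hS : ConnSet G S) (hT : ConnSet G T) (h : Touch G S T) :
    ConnSet G (S ∪ T) := by
  obtain ⟨a, ha, b, hb, hab⟩ := h
  refine connSet_of_forall (Or.inl ha) ?_
  rintro c (hc | hc)
  · exact (hS.2 c hc a ha).mono Set.subset_union_left
  · exact ((hT.2 c hc b hb).mono Set.subset_union_right).trans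
      (.of_adj hab.symm (Or.inr hb) (Or.inl ha))

lemma ConnSet.mono_graph (hS : ConnSet G S) (h : G ≤ H) : ConnSet H S :=
  ⟨hS.1, fun a ha b hb => (hS.2 a ha b hb).map_graph fun _ _ _ _ huv => h huv⟩

lemma Touch.mono_graph (hS : Touch G S T) (h : G ≤ H) : Touch H S T := by
  obtain ⟨a, ha, b, hb, hab⟩ := hS
  exact ⟨a, ha, b, hb, h hab⟩

lemma comp_subset : comp G S a ⊆ S := fun _ h => h.right_mem

lemma mem_comp_self (h : a ∈ S) : a ∈ comp G S a := .refl h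

lemma comp_closed (hu : u ∈ comp G S a) (h : G.Adj u v) (hv : v ∈ S) : v ∈ comp G S a :=
  hu.trans (.of_adj h hu.right_mem hv)

lemma reachIn_comp (h : ReachIn G S a b) : ReachIn G (comp G S a) a b :=
  h.invariant (P := fun w => ReachIn G (comp G S a) a w) (.refl (mem_comp_self h.left_mem))
    fun _ _ hu _ huv hv => hu.trans (.of_adj huv hu.right_mem (comp_closed hu.right_mem huv hv))

lemma connSet_comp (h : a ∈ S) : ConnSet G (comp G S a) :=
  connSet_of_forall (mem_comp_self h) fun _ hb => (reachIn_comp hb).symm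

lemma ConnSet.exists_touch (hS : ConnSet G S) (hTS : (S ∩ T).Nonempty) (h : ¬ S ⊆ T) :
    ∃ a ∈ S ∩ T, ∃ b ∈ S \ T, G.Adj a b := by
  by_contra! hcon
  obtain ⟨a, haS, haT⟩ := hTS
  refine h fun b hb => ?_
  exact (hS.2 a haS b hb).invariant (P := fun w => w ∈ T) haT fun u v hu hu' huv hv => by
    by_contra hvT
    exact hcon u ⟨hu', hu⟩ v ⟨hv, hvT⟩ huv

/-- Deleting a vertex `x` from a connected set leaves components adjacent to `x`. -/
lemma touch_comp (h : ReachIn G S a x) (ha : a ≠ x) : Touch G (comp G (S \ {x}) a) {x} := by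
  by_contra hcon
  have : x ∈ comp G (S \ {x}) a := by
    refine h.invariant (P := fun w => w ∈ comp G (S \ {x}) a) (mem_comp_self ⟨h.left_mem, ha⟩) ?_
    intro u v hu _ huv hv
    refine comp_closed hu huv ⟨hv, ?_⟩
    rintro rfl
    exact hcon ⟨u, hu, _, rfl, huv⟩
  exact this.right_mem.2 rfl

/-- Disjoint connected subsets of a connected set extend to a partition into two connected
sets. -/
lemma ConnSet.exists_partition [Finite V] (hK : ConnSet G T) {P Q : Set V} (hP : ConnSet G P)
    (hQ : ConnSet G Q) (hPK : P ⊆ T) (hQK : Q ⊆ T) (hd : Disjoint P Q) :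
    ∃ P' Q', P ⊆ P' ∧ Q ⊆ Q' ∧ ConnSet G P' ∧ ConnSet G Q' ∧ Disjoint P' Q' ∧ P' ∪ Q' = T ∧
      Touch G P' Q' := by
  induction hn : (T \ (P ∪ Q)).ncard using Nat.strong_induction_on generalizing P Q with
  | _ n ih =>
  subst hn
  by_cases hun : P ∪ Q = T
  · refine ⟨P, Q, subset_rfl, subset_rfl, hP, hQ, hd, hun, ?_⟩
    obtain ⟨q, hq⟩ := hQ.1
    obtain ⟨p, hp⟩ := hP.1
    obtain ⟨a, ha, b, hb, hab⟩ := hK.exists_touch (T := P) ⟨p, hPK hp, hp⟩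
      fun h => Set.disjoint_left.1 hd (h (hQK hq)) hq
    refine ⟨a, ha.2, b, ?_, hab⟩
    have := hun ▸ hb.1
    exact this.resolve_left hb.2
  obtain ⟨p, hp⟩ := hP.1
  obtain ⟨a, ha, b, hb, hab⟩ := hK.exists_touch (T := P ∪ Q) ⟨p, hPK hp, Or.inl hp⟩
    fun h => hun (Set.Subset.antisymm (Set.union_subset hPK hQK) h)
  have hbP : b ∉ P := fun h => hb.2 (Or.inl h)
  have hbQ : b ∉ Q := fun h => hb.2 (Or.inr h)
  have hlt : ∀ R, P ∪ Q ⊆ R → b ∈ R → (T \ R).ncard < (T \ (P ∪ Q)).ncard := by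
    intro R hR hbR
    exact Set.ncard_lt_ncard ⟨Set.sdiff_subset_sdiff_right hR, fun h => (h hb).2 hbR⟩
      (Set.toFinite _)
  have hbT : {b} ⊆ T := Set.singleton_subset_iff.2 hb.1
  rcases ha.2 with haP | haQ
  · have := hlt (P ∪ {b} ∪ Q) (Set.union_subset_union_left _ Set.subset_union_left)
      (Or.inl (Or.inr rfl))
    obtain ⟨P', Q', h1, h2, h⟩ := ih _ this
      (hP.union_of_touch (connSet_singleton b) ⟨a, haP, b, rfl, hab⟩) hQ
      (Set.union_subset hPK hbT) hQK
      (Set.disjoint_union_left.2 ⟨hd, Set.disjoint_singleton_left.2 hbQ⟩) rfl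
    exact ⟨P', Q', Set.subset_union_left.trans h1, h2, h⟩
  · have := hlt (P ∪ (Q ∪ {b})) (Set.union_subset_union_right _ Set.subset_union_left)
      (Or.inr (Or.inr rfl))
    obtain ⟨P', Q', h1, h2, h⟩ := ih _ this hP
      (hQ.union_of_touch (connSet_singleton b) ⟨a, haQ, b, rfl, hab⟩) hPK
      (Set.union_subset hQK hbT)
      (Set.disjoint_union_right.2 ⟨hd, Set.disjoint_singleton_right.2 hbP⟩) rfl
    exact ⟨P', Q', h1, Set.subset_union_left.trans h2, h⟩

/-- Deleting a component of `S \ {x}` from a connected set `S` keeps it connected. -/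
lemma ConnSet.diff_comp (hS : ConnSet G S) (hx : x ∈ S) :
    ConnSet G (S \ comp G (S \ {x}) a) := by
  refine connSet_of_forall (a := x) ⟨hx, fun h => h.right_mem.2 rfl⟩ ?_
  intro b hb
  obtain ⟨p, hp⟩ := hS.2 b hb.1 x hx
  have hbc := hb.2
  clear hb
  induction p with
  | nil => exact .refl ⟨hx, hbc⟩
  | @cons b b' x h p ih =>
    simp only [Walk.support_cons, List.mem_cons, forall_eq_or_imp] at hp
    by_cases hbx : b = x
    · subst hbx
      exact .refl ⟨hx, hbc⟩
    have hb' : b' ∉ comp G (S \ {x}) a := fun hb' => hbc (comp_closed hb' h.symm ⟨hp.1, hbx⟩)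
    exact ReachIn.trans (.of_adj h ⟨hp.1, hbc⟩ ⟨hp.2 _ p.start_mem_support, hb'⟩)
      (ih hx hp.2 hb')

/-! ### Cycles and pseudoforests inside a set -/

/-- The component of `x` inside `S` contains a cycle. -/
def CycleAt (G : SimpleGraph V) (S : Set V) (x : V) : Prop := HasCycle G (comp G S x)

lemma HasCycle.mono (h : HasCycle G S) (hST : S ⊆ T) : HasCycle G T := by
  obtain ⟨u, c, hc, h⟩ := h
  exact ⟨u, c, hc, fun w hw => hST (h w hw)⟩

lemma HasCycle.map_graph (h : HasCycle G S)
    (hGH : ∀ u ∈ S, ∀ v ∈ S, G.Adj u v → H.Adj u v) : HasCycle H S := by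
  obtain ⟨u, c, hc, h⟩ := h
  have hE : ∀ e ∈ c.edges, e ∈ H.edgeSet := by
    intro e he
    induction e with
    | _ p q =>
      exact hGH p (h _ (c.fst_mem_support_of_mem_edges he)) q
        (h _ (c.snd_mem_support_of_mem_edges he)) (c.adj_of_mem_edges he)
  exact ⟨u, c.transfer H hE, hc.transfer hE, by simpa using h⟩

lemma isCycle_triangle {c : V} (h₁ : G.Adj a b) (h₂ : G.Adj b c) (h₃ : G.Adj c a) :
    (Walk.cons h₁ (.cons h₂ (.cons h₃ .nil))).IsCycle := by
  have := h₁.ne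
  have := h₂.ne
  have := h₃.ne
  simp_all [Walk.cons_isCycle_iff, Walk.cons_isPath_iff, Ne.symm]

lemma hasCycle_of_triangle {c : V} (h₁ : G.Adj a b) (h₂ : G.Adj b c) (h₃ : G.Adj c a)
    (ha : a ∈ S) (hb : b ∈ S) (hc : c ∈ S) : HasCycle G S :=
  ⟨a, _, isCycle_triangle h₁ h₂ h₃, by simp [ha, hb, hc]⟩

/-- A cycle stays connected when a vertex is avoided. -/
lemma reachIn_cycle_diff {c : G.Walk u u} (hc : c.IsCycle) (ha : a ∈ c.support)
    (hb : b ∈ c.support) (hax : a ≠ x) (hbx : b ≠ x) :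
    ReachIn G ({w | w ∈ c.support} \ {x}) a b := by
  classical
  by_cases hx : x ∈ c.support
  · have hc' := hc.rotate hx
    have key : ∀ (d : G.Walk x x), d.IsCycle → ∀ p ∈ d.support, p ≠ x → ∀ q ∈ d.support, q ≠ x →
        ReachIn G ({w | w ∈ d.support} \ {x}) p q := by
      intro d hd p hp hpx q hq hqx
      cases d with
      | nil => simp at hp; exact absurd hp hpx
      | @cons _ v _ h d =>
        have hd' := (Walk.cons_isCycle_iff _ _).1 hd |>.1
        have : ∀ w, w ∈ (Walk.cons h d).support → w ≠ x →
            ReachIn G ({w | w ∈ (Walk.cons h d).support} \ {x}) v w := by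
          intro w hw hwx
          have hw : w ∈ d.support := by simpa [hwx] using hw
          refine ⟨d.takeUntil w hw, fun z hz => ⟨?_, ?_⟩⟩
          · simpa using Or.inr (d.support_takeUntil_subset_support hw hz)
          · rintro rfl
            exact Walk.endpoint_notMem_support_takeUntil hd' hw hwx.symm hz
        exact (this p hp hpx).symm.trans (this q hq hqx)
    refine (key _ hc' a ?_ hax b ?_ hbx).mono ?_
    · rwa [Walk.mem_support_rotate_iff]
    · rwa [Walk.mem_support_rotate_iff]
    · intro w hw
      simpa [Walk.mem_support_rotate_iff] using hw
  · refine (ReachIn.of_walk_mem ha hb).mono fun w hw => ⟨hw, ?_⟩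
    rintro rfl
    exact hx hw

lemma PseudoforestOn.mono (h : PseudoforestOn G T) (hST : S ⊆ T) : PseudoforestOn G S :=
  fun _ _ c c' hc hc' hS hS' hr =>
    h c c' hc hc' (fun w hw => hST (hS w hw)) (fun w hw => hST (hS' w hw)) (hr.mono hST)

lemma PseudoforestOn.of_adj_imp (h : PseudoforestOn H S)
    (hGH : ∀ u ∈ S, ∀ v ∈ S, G.Adj u v → H.Adj u v) : PseudoforestOn G S := by
  have hE : ∀ {u} (c : G.Walk u u), (∀ w ∈ c.support, w ∈ S) → ∀ e ∈ c.edges, e ∈ H.edgeSet := by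
    intro u c hS e he
    induction e with
    | _ p q =>
      exact hGH p (hS _ (c.fst_mem_support_of_mem_edges he)) q
        (hS _ (c.snd_mem_support_of_mem_edges he)) (c.adj_of_mem_edges he)
  intro u v c c' hc hc' hS hS' hr e
  have := h (c.transfer H (hE c hS)) (c'.transfer H (hE c' hS')) (hc.transfer _) (hc'.transfer _)
    (by simpa using hS) (by simpa using hS') (hr.map_graph hGH) e
  simpa using this

lemma pseudoforest_iff : Pseudoforest G ↔ PseudoforestOn G Set.univ := by
  constructor
  · intro h u v c c' hc hc' _ _ hr
    obtain ⟨p, -⟩ := hr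
    exact h c c' hc hc' ⟨p⟩
  · intro h u v c c' hc hc' ⟨p⟩
    exact h c c' hc hc' (by simp) (by simp) ⟨p, by simp⟩

lemma pseudoforestOn_induce {W : Set V} {S : Set W} :
    PseudoforestOn (G.induce W) S ↔ PseudoforestOn G (Subtype.val '' S) := by
  let f : G.induce W ↪g G := Embedding.induce W
  constructor
  · intro h u v c c' hc hc' hS hS' hr e
    have hW : ∀ w ∈ Subtype.val '' S, w ∈ W := by
      rintro _ ⟨w, -, rfl⟩
      exact w.2
    have lift : ∀ {u v} (p : G.Walk u v) (hp : ∀ w ∈ p.support, w ∈ Subtype.val '' S),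
        ∃ (hu : u ∈ W) (hv : v ∈ W) (q : (G.induce W).Walk ⟨u, hu⟩ ⟨v, hv⟩),
          (∀ w ∈ q.support, w ∈ S) ∧ q.map f.toHom = p ∧
            q.edges.map (Sym2.map Subtype.val) = p.edges := by
      intro u v p hp
      have hp' := fun w hw => hW w (hp w hw)
      refine ⟨_, _, p.induce W hp', ?_, p.map_induce _,
        ((p.induce W hp').edges_map f.toHom).symm.trans (congrArg Walk.edges (p.map_induce _))⟩
      intro w hw
      rw [Walk.support_induce, List.mem_attachWith] at hw
      obtain ⟨z, hz, hzw⟩ := hp w hw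
      rwa [← Subtype.ext hzw]
    obtain ⟨_, _, d, hd, hdc, hde⟩ := lift c hS
    obtain ⟨_, _, d', hd', hdc', hde'⟩ := lift c' hS'
    obtain ⟨p, hp⟩ := hr
    obtain ⟨_, _, q, hq, -⟩ := lift p hp
    have key := h d d' ((Walk.isCycle_map_iff_of_injective f.injective).1 (hdc ▸ hc))
      ((Walk.isCycle_map_iff_of_injective f.injective).1 (hdc' ▸ hc')) hd hd' ⟨q, hq⟩
    rw [← hde, ← hde', List.mem_map, List.mem_map]
    simp only [key]
  · intro h u v c c' hc hc' hS hS' hr e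
    have supp : ∀ {u v} (p : (G.induce W).Walk u v), (∀ w ∈ p.support, w ∈ S) →
        ∀ w ∈ (p.map f.toHom).support, w ∈ Subtype.val '' S := by
      intro u v p hp w hw
      rw [Walk.support_map] at hw
      obtain ⟨z, hz, rfl⟩ := List.mem_map.1 hw
      exact ⟨z, hp z hz, rfl⟩
    obtain ⟨p, hp⟩ := hr
    have key := h (c.map f.toHom) (c'.map f.toHom) (hc.map f.injective) (hc'.map f.injective)
      (supp c hS) (supp c' hS') ⟨p.map f.toHom, supp p hp⟩ (e.map f.toHom)
    have hinj : Function.Injective f.toHom := f.injective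
    rwa [Walk.edges_map, Walk.edges_map, List.mem_map_of_injective (Sym2.map.injective hinj),
      List.mem_map_of_injective (Sym2.map.injective hinj)] at key

lemma apexPseudoforest_induce_iff {W : Set V} : ApexPseudoforest (G.induce W) ↔
    ∃ s : Set V, s.Subsingleton ∧ PseudoforestOn G (W \ s) := by
  have key : ∀ s : Set W, Pseudoforest ((G.induce W).induce sᶜ) ↔
      PseudoforestOn G (W \ Subtype.val '' s) := by
    intro s
    rw [pseudoforest_iff, pseudoforestOn_induce, pseudoforestOn_induce, Set.image_univ,
      Subtype.range_coe]
    congr! 1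
    ext w
    simp
  constructor
  · rintro ⟨s, hs, h⟩
    exact ⟨_, hs.image _, (key s).1 h⟩
  · rintro ⟨s, hs, h⟩
    refine ⟨Subtype.val ⁻¹' s, hs.preimage Subtype.val_injective, (key _).2 (h.mono ?_)⟩
    rintro w ⟨hw, hws⟩
    exact ⟨hw, fun h => hws ⟨⟨w, hw⟩, h, rfl⟩⟩

lemma apexPseudoforest_iff : ApexPseudoforest G ↔
    ∃ s : Set V, s.Subsingleton ∧ PseudoforestOn G sᶜ := by
  refine exists_congr fun s => and_congr_right fun _ => ?_
  rw [pseudoforest_iff, pseudoforestOn_induce, Set.image_univ, Subtype.range_coe]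

/-- A vertex set whose two parts meet at most in `x` and have no other edges between them:
a walk inside the union can be retracted to either part. -/
lemma ReachIn.retract (hST : S ∩ T ⊆ {x}) (hE : ∀ a ∈ S \ T, ∀ b ∈ T \ S, ¬ G.Adj a b)
    (hu : u ∈ S) (h : ReachIn G (S ∪ T) u v) :
    (v ∈ S → ReachIn G S u v) ∧
      (v ∈ T → x ∈ S ∧ x ∈ T ∧ ReachIn G S u x ∧ ReachIn G T x v) := by
  have key : (v ∈ S ∧ ReachIn G S u v) ∨
      (v ∉ S ∧ x ∈ S ∧ x ∈ T ∧ ReachIn G S u x ∧ ReachIn G T x v) := by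
    refine h.invariant (P := fun v => (v ∈ S ∧ ReachIn G S u v) ∨
      (v ∉ S ∧ x ∈ S ∧ x ∈ T ∧ ReachIn G S u x ∧ ReachIn G T x v)) (Or.inl ⟨hu, .refl hu⟩) ?_
    rintro w w' (⟨hwS, hw⟩ | ⟨hwS, hxS, hxT, hux, hxw⟩) - hadj hw'
    · by_cases hw'S : w' ∈ S
      · exact Or.inl ⟨hw'S, hw.trans (.of_adj hadj hwS hw'S)⟩
      · have hw'T := hw'.resolve_left hw'S
        have hwT : w ∈ T := by
          by_contra hwT
          exact hE w ⟨hwS, hwT⟩ w' ⟨hw'T, hw'S⟩ hadj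
        obtain rfl : w = x := hST ⟨hwS, hwT⟩
        exact Or.inr ⟨hw'S, hwS, hwT, hw, .of_adj hadj hwT hw'T⟩
    · by_cases hw'S : w' ∈ S
      · have hw'T : w' ∈ T := by
          by_contra hw'T
          exact hE w' ⟨hw'S, hw'T⟩ w ⟨hxw.right_mem, hwS⟩ hadj.symm
        obtain rfl : w' = x := hST ⟨hw'S, hw'T⟩
        exact Or.inl ⟨hxS, hux⟩
      · exact Or.inr ⟨hw'S, hxS, hxT, hux,
          hxw.trans (.of_adj hadj hxw.right_mem (hw'.resolve_left hw'S))⟩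
  constructor
  · intro hv
    rcases key with h | h
    · exact h.2
    · exact absurd hv h.1
  · intro hv
    rcases key with h | h
    · obtain rfl : v = x := hST ⟨h.1, hv⟩
      exact ⟨h.1, hv, h.2, .refl hv⟩
    · exact h.2

lemma cycle_subset_or_subset (hST : S ∩ T ⊆ {x})
    (hE : ∀ a ∈ S \ T, ∀ b ∈ T \ S, ¬ G.Adj a b) {c : G.Walk u u} (hc : c.IsCycle)
    (h : ∀ w ∈ c.support, w ∈ S ∪ T) : (∀ w ∈ c.support, w ∈ S) ∨ (∀ w ∈ c.support, w ∈ T) := by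
  classical
  by_contra! hcon
  obtain ⟨⟨p, hp, hpS⟩, q, hq, hqT⟩ := hcon
  have hpT := (h p hp).resolve_left hpS
  have hqS := (h q hq).resolve_right hqT
  have hr : ReachIn G ({w | w ∈ c.support} \ (S ∩ T)) p q := by
    by_cases hx : x ∈ S ∩ T
    · have : S ∩ T = {x} := Set.Subset.antisymm hST (Set.singleton_subset_iff.2 hx)
      rw [this]
      exact reachIn_cycle_diff hc hp hq (fun h => hpS (h ▸ hx.1)) (fun h => hqT (h ▸ hx.2))
    · refine (ReachIn.of_walk_mem hp hq).mono fun w hw => ⟨hw, fun hw' => hx ?_⟩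
      obtain rfl : w = x := hST hw'
      exact hw'
  refine hr.invariant (P := fun w => w ∉ S) hpS ?_ hqS
  intro w w' hw hws hadj hw's hw'S
  have hw'T : w' ∉ T := fun h => hw's.2 ⟨hw'S, h⟩
  exact hE w' ⟨hw'S, hw'T⟩ w ⟨(h w hws.1).resolve_left hw, hw⟩ hadj.symm

lemma cycleAt_of_reachIn {c : G.Walk u u} (hc : c.IsCycle) (hS : ∀ w ∈ c.support, w ∈ S)
    (h : ReachIn G S x u) : CycleAt G S x := by
  classical
  exact ⟨u, c, hc, fun w hw =>
    h.trans ((ReachIn.of_walk_mem c.start_mem_support hw).mono fun _ h => hS _ h)⟩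

/-- Gluing two pseudoforests along at most one vertex. -/
lemma PseudoforestOn.union (hS : PseudoforestOn G S) (hT : PseudoforestOn G T)
    (hST : S ∩ T ⊆ {x}) (hE : ∀ a ∈ S \ T, ∀ b ∈ T \ S, ¬ G.Adj a b)
    (hx : x ∈ S → x ∈ T → CycleAt G S x → ¬ CycleAt G T x) : PseudoforestOn G (S ∪ T) := by
  have hTS : T ∩ S ⊆ {x} := by rwa [Set.inter_comm]
  have hE' : ∀ a ∈ T \ S, ∀ b ∈ S \ T, ¬ G.Adj a b := fun a ha b hb h => hE b hb a ha h.symm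
  have mixed : ∀ {u v} (c : G.Walk u u) (c' : G.Walk v v), c.IsCycle → c'.IsCycle →
      (∀ w ∈ c.support, w ∈ S) → (∀ w ∈ c'.support, w ∈ T) → ¬ ReachIn G (S ∪ T) u v := by
    intro u v c c' hc hc' hcS hcT hr
    obtain ⟨hxS, hxT, h1, h2⟩ := (hr.retract hST hE (hcS u c.start_mem_support)).2
      (hcT v c'.start_mem_support)
    exact hx hxS hxT (cycleAt_of_reachIn hc hcS h1.symm) (cycleAt_of_reachIn hc' hcT h2)
  intro u v c c' hc hc' hcU hcU' hr
  rcases cycle_subset_or_subset hST hE hc hcU with h | h <;>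
  rcases cycle_subset_or_subset hST hE hc' hcU' with h' | h'
  · exact hS c c' hc hc' h h' ((hr.retract hST hE (h u c.start_mem_support)).1
      (h' v c'.start_mem_support))
  · exact absurd hr (mixed c c' hc hc' h h')
  · exact absurd hr.symm (mixed c' c hc' hc h' h)
  · rw [Set.union_comm] at hr
    exact hT c c' hc hc' h h' ((hr.retract hTS hE' (h u c.start_mem_support)).1
      (h' v c'.start_mem_support))

/-- A connected set with two cycles sharing at most one vertex is not a pseudoforest. -/
lemma not_pseudoforestOn (hU : ConnSet G U) (hS : HasCycle G S) (hT : HasCycle G T)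
    (hSU : S ⊆ U) (hTU : T ⊆ U) (hST : (S ∩ T).Subsingleton) : ¬ PseudoforestOn G U := by
  intro h
  obtain ⟨u, c, hc, hcS⟩ := hS
  obtain ⟨v, c', hc', hcT⟩ := hT
  have key := h c c' hc hc' (fun w hw => hSU (hcS w hw)) (fun w hw => hTU (hcT w hw))
    (hU.2 _ (hSU (hcS _ c.start_mem_support)) _ (hTU (hcT _ c'.start_mem_support)))
  cases c with
  | nil => simp at hc
  | @cons _ w _ hadj c =>
    have := (key s(u, w)).1 (by simp)
    exact hadj.ne (hST ⟨hcS u (by simp), hcT u (c'.fst_mem_support_of_mem_edges this)⟩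
      ⟨hcS w (by simp), hcT w (c'.snd_mem_support_of_mem_edges this)⟩)

/-! ### Splitting along cycles -/

lemma exists_two_adj_of_mem_cycle {c : G.Walk u u} (hc : c.IsCycle) (hx : x ∈ c.support) :
    ∃ a ∈ c.support, ∃ b ∈ c.support, a ≠ b ∧ G.Adj x a ∧ G.Adj x b := by
  classical
  have hc' := hc.rotate hx
  have hmem : ∀ w, w ∈ (c.rotate x hx).support → w ∈ c.support := by
    simp [Walk.mem_support_rotate_iff]
  refine ⟨_, hmem _ (Walk.getVert_mem_support _ _), _, hmem _ (Walk.getVert_mem_support _ _),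
    hc'.snd_ne_penultimate, Walk.adj_snd hc'.not_nil, (Walk.adj_penultimate hc'.not_nil).symm⟩

/-- Three pairwise disjoint and pairwise adjacent connected sets with union `S`. -/
structure Tripod (G : SimpleGraph V) (S P Q R : Set V) : Prop where
  conn₁ : ConnSet G P
  conn₂ : ConnSet G Q
  conn₃ : ConnSet G R
  disj₁₂ : Disjoint P Q
  disj₁₃ : Disjoint P R
  disj₂₃ : Disjoint Q R
  touch₁₂ : Touch G P Q
  touch₁₃ : Touch G P R
  touch₂₃ : Touch G Q R
  union : P ∪ Q ∪ R = S

namespace Tripod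

lemma swap₂₃ (h : Tripod G S P Q R) : Tripod G S P R Q :=
  ⟨h.conn₁, h.conn₃, h.conn₂, h.disj₁₃, h.disj₁₂, h.disj₂₃.symm, h.touch₁₃, h.touch₁₂,
    h.touch₂₃.symm, by rw [← h.union, Set.union_right_comm]⟩

lemma subset₁ (h : Tripod G S P Q R) : P ⊆ S := fun _ hz => h.union ▸ Or.inl (Or.inl hz)

lemma subset₂ (h : Tripod G S P Q R) : Q ⊆ S := fun _ hz => h.union ▸ Or.inl (Or.inr hz)

lemma subset₃ (h : Tripod G S P Q R) : R ⊆ S := fun _ hz => h.union ▸ Or.inr hz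

lemma mem (h : Tripod G S P Q R) (hx : x ∈ S) : x ∈ P ∨ x ∈ Q ∨ x ∈ R := by
  rwa [← h.union, Set.mem_union, Set.mem_union, or_assoc] at hx

lemma mono_graph (h : Tripod G S P Q R) (hGH : G ≤ H) : Tripod H S P Q R :=
  ⟨h.conn₁.mono_graph hGH, h.conn₂.mono_graph hGH, h.conn₃.mono_graph hGH, h.disj₁₂, h.disj₁₃,
    h.disj₂₃, h.touch₁₂.mono_graph hGH, h.touch₁₃.mono_graph hGH, h.touch₂₃.mono_graph hGH,
    h.union⟩

end Tripod

lemma exists_connSet_inter_eq_singleton {D : Set V} (h : ReachIn G S x y) (hy : y ∈ D) :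
    ∃ X ⊆ S, ConnSet G X ∧ x ∈ X ∧ ∃ d ∈ D, X ∩ D = {d} := by
  obtain ⟨p, hp⟩ := h
  have hself : ∀ x ∈ S, x ∈ D → ∃ X ⊆ S, ConnSet G X ∧ x ∈ X ∧ ∃ d ∈ D, X ∩ D = {d} :=
    fun x hx hxD => ⟨{x}, by simpa, connSet_singleton x, rfl, x, hxD, by simpa⟩
  induction p with
  | nil => exact hself _ (hp _ (by simp)) hy
  | @cons x x' _ h p ih =>
    simp only [Walk.support_cons, List.mem_cons, forall_eq_or_imp] at hp
    by_cases hxD : x ∈ D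
    · exact hself x hp.1 hxD
    obtain ⟨X, hXS, hX, hx'X, d, hd, hXd⟩ := ih hy hp.2
    refine ⟨{x} ∪ X, Set.union_subset (by simpa using hp.1) hXS,
      (connSet_singleton x).union_of_touch hX ⟨x, rfl, x', hx'X, h⟩, Or.inl rfl, d, hd, ?_⟩
    rw [Set.union_inter_distrib_right, hXd, Set.singleton_inter_eq_empty.2 hxD, Set.empty_union]

/-- A connected set containing a cycle splits into three pairwise adjacent connected parts. -/
lemma exists_tripod [Finite V] (hS : ConnSet G S) (hx : x ∈ S) (hc : HasCycle G S) :
    ∃ P Q R, Tripod G S P Q R ∧ x ∈ P := by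
  classical
  obtain ⟨u, c, hc, hcS⟩ := hc
  obtain ⟨X, hXS, hX, hxX, d, hd, hXd⟩ := exists_connSet_inter_eq_singleton
    (D := {w | w ∈ c.support}) (hS.2 x hx u (hcS u c.start_mem_support)) c.start_mem_support
  obtain ⟨n₁, hn₁, n₂, hn₂, hne, ha₁, ha₂⟩ := exists_two_adj_of_mem_cycle hc hd
  have hdX : d ∈ X := (hXd.symm.subset rfl).1
  have hD : ConnSet G ({w | w ∈ c.support} \ {d}) :=
    connSet_of_forall (a := n₁) ⟨hn₁, ha₁.ne'⟩ fun b hb =>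
      reachIn_cycle_diff hc hb.1 hn₁ hb.2 ha₁.ne'
  obtain ⟨P, Q, h₁, h₂, hP, hQ, hPQ, hun, ht⟩ := hD.exists_partition (connSet_singleton n₁)
    (connSet_singleton n₂) (by simpa using ⟨hn₁, ha₁.ne'⟩) (by simpa using ⟨hn₂, ha₂.ne'⟩)
    (by simpa using hne)
  have hXD : Disjoint X (P ∪ Q) := by
    rw [hun, Set.disjoint_left]
    exact fun w hw hw' => hw'.2 (hXd.subset ⟨hw, hw'.1⟩)
  obtain ⟨X', Y, hXX', hY, hX', hY', hXY, hun', -⟩ := hS.exists_partition hX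
    (hP.union_of_touch hQ ht) hXS (hun ▸ fun w hw => hcS w hw.1) hXD
  rw [Set.union_subset_iff] at hY
  obtain ⟨P', Q', hPP', hQQ', hP', hQ', hPQ', hun'', ht'⟩ := hY'.exists_partition hP hQ
    hY.1 hY.2 hPQ
  refine ⟨X', P', Q', ⟨hX', hP', hQ', hXY.mono_right ?_, hXY.mono_right ?_, hPQ',
    ⟨d, hXX' hdX, n₁, hPP' (h₁ rfl), ha₁⟩, ⟨d, hXX' hdX, n₂, hQQ' (h₂ rfl), ha₂⟩, ht', ?_⟩,
    hXX' hxX⟩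
  · exact hun'' ▸ Set.subset_union_left
  · exact hun'' ▸ Set.subset_union_right
  · rw [Set.union_assoc, hun'', hun']

/-! ### Minor models -/

/-- The sets in the list `L` are branch sets of a model in `G` of the graph with edge list `E`. -/
structure IsModel (G : SimpleGraph V) (E : List (ℕ × ℕ)) (L : List (Set V)) : Prop where
  conn : ∀ A ∈ L, ConnSet G A
  disj : L.Pairwise Disjoint
  touch : ∀ e ∈ E, Touch G (L.getD e.1 ∅) (L.getD e.2 ∅)

lemma IsModel.isMinorOf {E : List (ℕ × ℕ)} {L : List (Set V)} (h : IsModel G E L) {n : ℕ}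
    (hn : L.length = n) : IsMinorOf (mkGraph n E) G := by
  subst hn
  refine ⟨fun i => L[i], fun i => connSet_iff.1 (h.conn _ (List.getElem_mem _)), ?_, ?_⟩
  · intro i j hij
    rcases lt_or_gt_of_ne hij with hlt | hlt
    · exact List.pairwise_iff_getElem.1 h.disj _ _ i.2 j.2 hlt
    · exact (List.pairwise_iff_getElem.1 h.disj _ _ j.2 i.2 hlt).symm
  · rintro i j ⟨-, hij | hij⟩
    · simpa [Touch] using h.touch _ hij
    · simpa [Touch] using (h.touch _ hij).symm

lemma IsModel.append {E E' : List (ℕ × ℕ)} {L L' : List (Set V)} (h : IsModel G E L)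
    (h' : IsModel G E' L') (hL : ∀ A ∈ L, A ⊆ S) (hL' : ∀ A ∈ L', A ⊆ T) (hST : Disjoint S T) :
    IsModel G (E ++ E'.map fun e => (L.length + e.1, L.length + e.2)) (L ++ L') := by
  refine ⟨?_, ?_, ?_⟩
  · intro A hA
    exact (List.mem_append.1 hA).elim (h.conn A) (h'.conn A)
  · exact List.pairwise_append.2 ⟨h.disj, h'.disj, fun A hA B hB => hST.mono (hL A hA) (hL' B hB)⟩
  · have lt : ∀ i, (L.getD i ∅).Nonempty → i < L.length := by
      intro i hi
      by_contra hlt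
      rw [List.getD_eq_default _ _ (by omega)] at hi
      simp at hi
    intro e he
    rcases List.mem_append.1 he with he | he
    · obtain ⟨a, ha, b, hb, hab⟩ := h.touch e he
      refine ⟨a, ?_, b, ?_, hab⟩
      · rwa [List.getD_append _ _ _ _ (lt _ ⟨a, ha⟩)]
      · rwa [List.getD_append _ _ _ _ (lt _ ⟨b, hb⟩)]
    · obtain ⟨e, he', rfl⟩ := List.mem_map.1 he
      rw [List.getD_append_right _ _ _ _ (Nat.le_add_right _ _),
        List.getD_append_right _ _ _ _ (Nat.le_add_right _ _), Nat.add_sub_cancel_left,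
        Nat.add_sub_cancel_left]
      exact h'.touch e he'

abbrev diamondEdges : List (ℕ × ℕ) := [(0,1),(0,2),(0,3),(1,2),(1,3)]

abbrev butterflyEdges : List (ℕ × ℕ) := [(0,1),(0,2),(1,2),(0,3),(0,4),(3,4)]

/-- `S` contains a model with `n` branch sets of the graph with edge list `E`. -/
def HasModel (G : SimpleGraph V) (n : ℕ) (E : List (ℕ × ℕ)) (S : Set V) : Prop :=
  ∃ L : List (Set V), L.length = n ∧ (∀ A ∈ L, A ⊆ S) ∧ IsModel G E L

lemma HasModel.isMinorOf {E E' : List (ℕ × ℕ)} {m n : ℕ} (h : HasModel G m E S)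
    (h' : HasModel G n E' T) (hST : Disjoint S T) :
    IsMinorOf (mkGraph (m + n) (E ++ E'.map fun e => (m + e.1, m + e.2))) G := by
  obtain ⟨L, rfl, hL, hm⟩ := h
  obtain ⟨L', rfl, hL', hm'⟩ := h'
  exact (hm.append hm' hL hL' hST).isMinorOf (by simp)

/-! ### Diamonds and butterflies in non-pseudoforests -/

lemma hasModel_diamond {A B C D : Set V} (hA : ConnSet G A) (hB : ConnSet G B) (hC : ConnSet G C)
    (hD : ConnSet G D) (dAB : Disjoint A B) (dAC : Disjoint A C) (dAD : Disjoint A D)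
    (dBC : Disjoint B C) (dBD : Disjoint B D) (dCD : Disjoint C D) (tAB : Touch G A B)
    (tAC : Touch G A C) (tAD : Touch G A D) (tBC : Touch G B C) (tBD : Touch G B D)
    (hS : A ∪ B ∪ C ∪ D ⊆ S) : HasModel G 4 diamondEdges S := by
  simp only [Set.union_subset_iff] at hS
  exact ⟨[A, B, C, D], rfl, by simp [hS], by simp [*], by simp [*], by simp [*]⟩

/-- Two adjacent connected sets joined by two distinct edges, together with a common neighbouring
connected set, contain a diamond model. -/
lemma hasModel_diamond_of_two_edges [Finite V] {p p' q q' : V} (hP : ConnSet G P)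
    (hQ : ConnSet G Q) (hR : ConnSet G R) (dPQ : Disjoint P Q) (dPR : Disjoint P R)
    (dQR : Disjoint Q R) (tPR : Touch G P R) (tQR : Touch G Q R) (hp : p ∈ P) (hp' : p' ∈ P)
    (hq : q ∈ Q) (hq' : q' ∈ Q) (h : G.Adj p q) (h' : G.Adj p' q') (hne : p ≠ p')
    (hS : P ∪ Q ∪ R ⊆ S) : HasModel G 4 diamondEdges S := by
  obtain ⟨P₁, P₂, h₁, h₂, hP₁, hP₂, d₁₂, rfl, t₁₂⟩ := hP.exists_partition (connSet_singleton p)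
    (connSet_singleton p') (by simpa) (by simpa) (by simpa)
  rw [Set.disjoint_union_left] at dPQ dPR
  simp only [Set.union_subset_iff] at hS
  have t₁ : Touch G P₁ Q := ⟨p, h₁ rfl, q, hq, h⟩
  have t₂ : Touch G P₂ Q := ⟨p', h₂ rfl, q', hq', h'⟩
  obtain ⟨a, ha | ha, b, hb, hab⟩ := tPR
  · exact hasModel_diamond hP₁ hQ hP₂ hR dPQ.1 d₁₂ dPR.1 dPQ.2.symm dQR dPR.2 t₁ t₁₂
      ⟨a, ha, b, hb, hab⟩ t₂.symm tQR (by simp [hS])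
  · exact hasModel_diamond hP₂ hQ hP₁ hR dPQ.2 d₁₂.symm dPR.2 dPQ.1.symm dQR dPR.1 t₂ t₁₂.symm
      ⟨a, ha, b, hb, hab⟩ t₁.symm tQR (by simp [hS])

lemma Tripod.hasModel_diamond_of_adj [Finite V] {p q : V}
    (h : Tripod (G.deleteEdges {s(p, q)}) U P Q R) (hp : p ∈ P) (hq : q ∈ Q) (hpq : G.Adj p q) (hS : U ⊆ S) : HasModel G 4 diamondEdges S := by
  obtain ⟨p', hp', q', hq', hadj⟩ := h.touch₁₂
  rw [deleteEdges_adj] at hadj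
  have h := h.mono_graph (deleteEdges_le {s(p, q)})
  by_cases hne : p = p'
  · subst hne
    refine hasModel_diamond_of_two_edges h.conn₂ h.conn₁ h.conn₃ h.disj₁₂.symm h.disj₂₃ h.disj₁₃
      h.touch₂₃ h.touch₁₃ hq hq' hp hp hpq.symm hadj.1.symm ?_
      (by rw [Set.union_comm Q]; exact h.union.trans_subset hS)
    rintro rfl
    exact hadj.2 rfl
  · exact hasModel_diamond_of_two_edges h.conn₁ h.conn₂ h.conn₃ h.disj₁₂ h.disj₁₃ h.disj₂₃
      h.touch₁₃ h.touch₂₃ hp hp' hq hq' hpq hadj.1 hne (h.union.trans_subset hS)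

lemma hasCycle_of_reachIn_deleteEdges (h : G.Adj a b)
    (hr : ReachIn (G.deleteEdges {s(a, b)}) S a b) : HasCycle G S := by
  classical
  obtain ⟨p, hp⟩ := hr
  have hle : G.deleteEdges {s(a, b)} ≤ G := deleteEdges_le _
  have hpath := p.bypass_isPath
  refine ⟨b, .cons h.symm (p.bypass.mapLe hle), ?_, ?_⟩
  · rw [Walk.cons_isCycle_iff]
    refine ⟨hpath.mapLe hle, fun he => ?_⟩
    rw [Walk.edges_mapLe_eq_edges] at he
    simpa [Sym2.eq_swap] using Walk.edges_subset_edgeSet _ he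
  · intro w hw
    rw [Walk.support_cons, Walk.support_mapLe_eq_support] at hw
    rcases List.mem_cons.1 hw with rfl | hw
    · exact hp _ p.end_mem_support
    · exact hp _ (p.support_bypass_subset_support hw)

/-- Deleting an edge of a cycle keeps its ends connected along the cycle. -/
lemma reachIn_deleteEdges_of_mem_cycle {c : G.Walk u u} (hc : c.IsCycle) (he : s(a, b) ∈ c.edges) :
    ReachIn (G.deleteEdges {s(a, b)}) {w | w ∈ c.support} a b := by
  let K : SimpleGraph V := fromEdgeSet {e | e ∈ c.edges}
  have hK : ∀ e ∈ c.edges, e ∈ K.edgeSet := by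
    intro e he
    rw [edgeSet_fromEdgeSet]
    exact ⟨he, G.not_isDiag_of_mem_edgeSet (c.edges_subset_edgeSet he)⟩
  obtain ⟨-, p⟩ := (adj_and_reachable_delete_edges_iff_exists_cycle (G := K) (v := a) (w := b)).2
    ⟨u, c.transfer K hK, hc.transfer hK, by simpa using he⟩
  obtain ⟨p⟩ := p
  have hr : ReachIn (K \ fromEdgeSet {s(a, b)}) Set.univ a b := ⟨p, by simp⟩
  refine hr.invariant (P := fun w => ReachIn (G.deleteEdges {s(a, b)}) {w | w ∈ c.support} a w)
    (.refl (c.fst_mem_support_of_mem_edges he)) ?_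
  intro w w' hw _ hadj _
  simp only [K, sdiff_adj, fromEdgeSet_adj] at hadj
  have hmem : s(w, w') ∈ c.edges := hadj.1.1
  refine hw.trans (.of_adj ?_ hw.right_mem (c.snd_mem_support_of_mem_edges hmem))
  rw [deleteEdges_adj]
  exact ⟨c.adj_of_mem_edges hmem, fun h => hadj.2 ⟨h, hadj.1.2⟩⟩

lemma Tripod.hasModel_of_hasCycle [Finite V] (h : Tripod G U P Q R) (hc : HasCycle G P)
    (hS : U ⊆ S) : HasModel G 4 diamondEdges S ∨ HasModel G 5 butterflyEdges S := by
  obtain ⟨r, hr, q, hq, hrq⟩ := h.touch₁₂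
  obtain ⟨P₁, P₂, P₃, hT, hr₁⟩ := exists_tripod h.conn₁ hr hc
  have t₁ : Touch G P₁ Q := ⟨r, hr₁, q, hq, hrq⟩
  have hW : ConnSet G (Q ∪ R) := h.conn₂.union_of_touch h.conn₃ h.touch₂₃
  have dW : Disjoint P (Q ∪ R) := Set.disjoint_union_right.2 ⟨h.disj₁₂, h.disj₁₃⟩
  have d₁ := dW.mono_left hT.subset₁
  have d₂ := dW.mono_left hT.subset₂
  have d₃ := dW.mono_left hT.subset₃
  have hsub : P₁ ∪ P₂ ∪ P₃ ∪ Q ∪ R ⊆ S := by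
    rw [hT.union]
    exact h.union.trans_subset hS
  have hconn := And.intro hT.conn₁ (And.intro hT.conn₂ hT.conn₃)
  obtain ⟨a, ha, b, hb, hab⟩ := h.touch₁₃
  simp only [Set.union_subset_iff] at hsub
  rcases hT.mem ha with ha | ha | ha
  · right
    rw [Set.disjoint_union_right] at d₁ d₂ d₃
    have := Touch.mono (G := G) (T := R) ⟨a, ha, b, hb, hab⟩ subset_rfl subset_rfl
    exact ⟨[P₁, P₂, P₃, Q, R], rfl, by simp [hsub],
      by simp [hT.conn₁, hT.conn₂, hT.conn₃, h.conn₂, h.conn₃],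
      by simp [d₁, d₂, d₃, hT.disj₁₂, hT.disj₁₃, hT.disj₂₃, h.disj₂₃],
      by simp [this, t₁, hT.touch₁₂, hT.touch₁₃, hT.touch₂₃, h.touch₂₃]⟩
  · left
    exact hasModel_diamond hT.conn₁ hT.conn₂ hT.conn₃ hW hT.disj₁₂ hT.disj₁₃ d₁ hT.disj₂₃ d₂ d₃
      hT.touch₁₂ hT.touch₁₃ (t₁.mono subset_rfl Set.subset_union_left) hT.touch₂₃
      ⟨a, ha, b, Or.inr hb, hab⟩ (by simp [hsub])
  · left
    exact hasModel_diamond hT.conn₁ hT.conn₃ hT.conn₂ hW hT.disj₁₃ hT.disj₁₂ d₁ hT.disj₂₃.symm d₃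
      d₂ hT.touch₁₃ hT.touch₁₂ (t₁.mono subset_rfl Set.subset_union_left) hT.touch₂₃.symm
      ⟨a, ha, b, Or.inr hb, hab⟩ (by simp [hsub])

lemma hasModel_of_two_cycles [Finite V] {c : G.Walk u u} {c' : G.Walk v v} (hc : c.IsCycle)
    (hc' : c'.IsCycle) (hcS : ∀ w ∈ c.support, w ∈ S) (hcS' : ∀ w ∈ c'.support, w ∈ S)
    (hr : ReachIn G S u v) {e : Sym2 V} (he : e ∈ c.edges) (he' : e ∉ c'.edges) :
    HasModel G 4 diamondEdges S ∨ HasModel G 5 butterflyEdges S := by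
  classical
  induction e with
  | _ p q =>
    have hpq := c.adj_of_mem_edges he
    have hcU : ∀ w ∈ c.support, w ∈ comp G S u := fun w hw =>
      (ReachIn.of_walk_mem c.start_mem_support hw).mono hcS
    have hcU' : ∀ w ∈ c'.support, w ∈ comp G S u := fun w hw =>
      hr.trans ((ReachIn.of_walk_mem c'.start_mem_support hw).mono hcS')
    have hp := c.fst_mem_support_of_mem_edges he
    have hbypass := (reachIn_deleteEdges_of_mem_cycle hc he).mono hcU
    have hconn : ConnSet (G.deleteEdges {s(p, q)}) (comp G S u) := by
      have hU := connSet_comp (G := G) (hcS u c.start_mem_support)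
      refine ⟨hU.1, fun a ha b hb => ?_⟩
      refine (hU.2 a ha b hb).invariant
        (P := fun w => ReachIn (G.deleteEdges {s(p, q)}) (comp G S u) a w) (.refl ha) ?_
      intro w w' hw hwU hadj hwU'
      by_cases heq : s(w, w') = s(p, q)
      · rcases Sym2.eq_iff.1 heq with ⟨rfl, rfl⟩ | ⟨rfl, rfl⟩
        · exact hw.trans hbypass
        · exact hw.trans hbypass.symm
      · exact hw.trans (.of_adj (deleteEdges_adj.2 ⟨hadj, heq⟩) hwU hwU')
    have hcyc : HasCycle (G.deleteEdges {s(p, q)}) (comp G S u) := by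
      have hE : ∀ e ∈ c'.edges, e ∈ (G.deleteEdges {s(p, q)}).edgeSet := by
        intro e hec
        rw [edgeSet_deleteEdges]
        refine ⟨c'.edges_subset_edgeSet hec, ?_⟩
        rintro rfl
        exact he' hec
      exact ⟨v, c'.transfer _ hE, hc'.transfer hE, by simpa using hcU'⟩
    obtain ⟨P, Q, R, hT, hpP⟩ := exists_tripod hconn (hcU p hp) hcyc
    rcases hT.mem (hcU q (c.snd_mem_support_of_mem_edges he)) with hq | hq | hq
    · exact (hT.mono_graph (deleteEdges_le _)).hasModel_of_hasCycle
        (hasCycle_of_reachIn_deleteEdges hpq (hT.conn₁.2 p hpP q hq)) comp_subset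
    · exact Or.inl (hT.hasModel_diamond_of_adj hpP hq hpq comp_subset)
    · exact Or.inl (hT.swap₂₃.hasModel_diamond_of_adj hpP hq hpq comp_subset)

/-- A set that does not induce a pseudoforest contains a model of the diamond or of the
butterfly. -/
lemma hasModel_of_not_pseudoforestOn [Finite V] (h : ¬ PseudoforestOn G S) :
    HasModel G 4 diamondEdges S ∨ HasModel G 5 butterflyEdges S := by
  simp only [PseudoforestOn, not_forall] at h
  obtain ⟨u, v, c, c', hc, hc', hcS, hcS', hr, e, he⟩ := h
  by_cases hec : e ∈ c.edges
  · exact hasModel_of_two_cycles hc hc' hcS hcS' hr hec fun h => he (iff_of_true hec h)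
  · refine hasModel_of_two_cycles hc' hc hcS' hcS hr.symm (e := e) ?_ hec
    by_contra h
    exact he (iff_of_false hec h)

/-! ### Obstructions in the list that are not apex-pseudoforests -/

instance mkGraphDecidableAdj (n : ℕ) (E : List (ℕ × ℕ)) : DecidableRel (mkGraph n E).Adj :=
  fun a b => decidable_of_iff (a ≠ b ∧ (((a : ℕ), (b : ℕ)) ∈ E ∨ ((b : ℕ), (a : ℕ)) ∈ E)) Iff.rfl

/-- The triangles `abc` and `def` avoid `v`, with `b` outside the second triangle, and `a` is joined
to `d` by a walk avoiding `v` with at most one inner vertex `m`. -/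
abbrev TwoTriangles (G : SimpleGraph V) (v a b c d e f m : V) : Prop :=
  (G.Adj a b ∧ G.Adj b c ∧ G.Adj c a) ∧ (G.Adj d e ∧ G.Adj e f ∧ G.Adj f d) ∧
    (v ≠ a ∧ v ≠ b ∧ v ≠ c ∧ v ≠ d ∧ v ≠ e ∧ v ≠ f ∧ v ≠ m) ∧ (b ≠ d ∧ b ≠ e ∧ b ≠ f) ∧
    (a = d ∨ G.Adj a m ∧ (m = d ∨ G.Adj m d))

lemma not_pseudoforestOn_of_twoTriangles {c d e f m : V} (h : TwoTriangles G v a b c d e f m) :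
    ¬ PseudoforestOn G {v}ᶜ := by
  obtain ⟨⟨h₁, h₂, h₃⟩, ⟨h₄, h₅, h₆⟩, hv, hb, had⟩ := h
  intro hPF
  have hr : ReachIn G {v}ᶜ a d := by
    rcases had with rfl | ⟨ham, rfl | hmd⟩
    · exact .refl hv.1.symm
    · exact .of_adj ham hv.1.symm (by simp [hv, Ne.symm])
    · exact .trans (.of_adj ham hv.1.symm hv.2.2.2.2.2.2.symm)
        (.of_adj hmd hv.2.2.2.2.2.2.symm hv.2.2.2.1.symm)
  have key := (hPF _ _ (isCycle_triangle h₁ h₂ h₃) (isCycle_triangle h₄ h₅ h₆)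
    (by simp [hv, eq_comm (b := v)]) (by simp [hv, eq_comm (b := v)]) hr s(a, b)).1 (by simp)
  have := Walk.snd_mem_support_of_mem_edges _ key
  simp [hb] at this

lemma not_apexPseudoforest_of_twoTriangles [Nonempty V]
    (h : ∀ v, ∃ a b c d e f m, TwoTriangles G v a b c d e f m) : ¬ ApexPseudoforest G := by
  have key : ∀ v, ¬ PseudoforestOn G {v}ᶜ := by
    intro v
    obtain ⟨a, b, c, d, e, f, m, h⟩ := h v
    exact not_pseudoforestOn_of_twoTriangles h
  rw [apexPseudoforest_iff]
  rintro ⟨s, hs, hPF⟩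
  rcases hs.eq_empty_or_singleton with rfl | ⟨v, rfl⟩
  · exact key (Classical.arbitrary V) (hPF.mono (by simp))
  · exact key v hPF

lemma not_apexPseudoforest_of_certificate {n : ℕ} [NeZero n] {H : SimpleGraph (Fin n)}
    (L : List (Fin n × Fin n × Fin n × Fin n × Fin n × Fin n × Fin n))
    (h : ∀ v, ∃ t ∈ L, TwoTriangles H v t.1 t.2.1 t.2.2.1 t.2.2.2.1 t.2.2.2.2.1 t.2.2.2.2.2.1
      t.2.2.2.2.2.2) : ¬ ApexPseudoforest H := by
  refine not_apexPseudoforest_of_twoTriangles fun v => ?_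
  obtain ⟨t, -, ht⟩ := h v
  exact ⟨_, _, _, _, _, _, _, ht⟩

lemma not_apexPseudoforest_O1 : ¬ ApexPseudoforest O1 :=
  not_apexPseudoforest_of_certificate [(0,2,1,0,1,3,0), (4,6,5,4,5,7,4)] (by unfold O1; decide)

lemma not_apexPseudoforest_O2 : ¬ ApexPseudoforest O2 :=
  not_apexPseudoforest_of_certificate [(0,1,2,0,3,4,0), (5,6,7,5,8,9,5)] (by unfold O2; decide)

lemma not_apexPseudoforest_O3 : ¬ ApexPseudoforest O3 :=
  not_apexPseudoforest_of_certificate [(0,2,1,0,1,3,0), (4,5,6,4,7,8,4)] (by unfold O3; decide)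

lemma not_apexPseudoforest_O4 : ¬ ApexPseudoforest O4 :=
  not_apexPseudoforest_of_certificate
    [(2,0,1,2,3,4,2), (5,6,7,5,3,4,5), (2,0,1,5,6,7,3), (2,0,1,5,6,7,4)] (by unfold O4; decide)

lemma not_apexPseudoforest_O12 : ¬ ApexPseudoforest O12 :=
  not_apexPseudoforest_of_certificate [(3,4,5,6,7,8,6), (2,0,1,7,6,8,7), (2,0,1,3,4,5,3)]
    (by unfold O12; decide)

lemma not_apexPseudoforest_O13 : ¬ ApexPseudoforest O13 :=
  not_apexPseudoforest_of_certificate [(3,4,5,8,6,7,8), (2,0,1,8,6,7,8), (2,0,1,3,4,5,3)]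
    (by unfold O13; decide)

lemma not_apexPseudoforest_O15 : ¬ ApexPseudoforest O15 :=
  not_apexPseudoforest_of_certificate [(4,3,2,4,5,6,4), (2,0,1,4,5,6,4), (2,0,1,2,3,4,2),
    (6,4,5,6,7,8,6), (2,0,1,6,7,8,6)] (by unfold O15; decide)

/-! ### Obstructions outside the list -/

/-- `G` is an obstruction outside the list. -/
def NewObs (G : SimpleGraph V) : Prop := ObsApexPseudoforest G ∧ ¬ InO G

namespace NewObs

lemma not_minor (h : NewObs G) {n : ℕ} {H : SimpleGraph (Fin n)} (hH : ⟨n, H⟩ ∈ OList)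
    (hna : ¬ ApexPseudoforest H) : ¬ IsMinorOf H G := fun hm =>
  hna (h.1.2 (Fin n) H hm ⟨fun e => h.2 ⟨_, hH, ⟨e.symm⟩⟩⟩)

lemma not_pseudoforestOn_compl (h : NewObs G) {s : Set V} (hs : s.Subsingleton) :
    ¬ PseudoforestOn G sᶜ := fun hPF => h.1.1 (apexPseudoforest_iff.2 ⟨s, hs, hPF⟩)

lemma not_pseudoforestOn_compl_singleton (h : NewObs G) (v : V) : ¬ PseudoforestOn G {v}ᶜ :=
  h.not_pseudoforestOn_compl Set.subsingleton_singleton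

lemma not_pseudoforestOn_univ (h : NewObs G) : ¬ PseudoforestOn G Set.univ := by
  simpa using h.not_pseudoforestOn_compl Set.subsingleton_empty

lemma not_pseudoforestOn_disjoint [Finite V] (h : NewObs G) (hST : Disjoint S T)
    (hS : ¬ PseudoforestOn G S) : PseudoforestOn G T := by
  by_contra hT
  rcases hasModel_of_not_pseudoforestOn hS with hS | hS <;>
  rcases hasModel_of_not_pseudoforestOn hT with hT | hT
  · exact h.not_minor (H := O1) (by simp [OList]) not_apexPseudoforest_O1 (hS.isMinorOf hT hST)
  · exact h.not_minor (H := O3) (by simp [OList]) not_apexPseudoforest_O3 (hS.isMinorOf hT hST)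
  · exact h.not_minor (H := O3) (by simp [OList]) not_apexPseudoforest_O3
      (hT.isMinorOf hS hST.symm)
  · exact h.not_minor (H := O2) (by simp [OList]) not_apexPseudoforest_O2 (hS.isMinorOf hT hST)

lemma apex_of_minor [Finite V] (h : NewObs G) {K : SimpleGraph V} {W : Set V} (hW : W ≠ Set.univ)
    (hm : IsMinorOf (K.induce W) G) : ∃ s : Set V, s.Subsingleton ∧ PseudoforestOn K (W \ s) := by
  refine apexPseudoforest_induce_iff.1 (h.1.2 W _ hm ⟨fun e => hW ?_⟩)
  have hcard := Nat.card_congr e.toEquiv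
  rw [Nat.card_coe_set_eq, ← Set.ncard_univ] at hcard
  exact Set.eq_of_subset_of_ncard_le (Set.subset_univ W) hcard.ge

lemma apex_of_ne_univ [Finite V] (h : NewObs G) {W : Set V} (hW : W ≠ Set.univ) :
    ∃ s : Set V, s.Subsingleton ∧ PseudoforestOn G (W \ s) := by
  refine h.apex_of_minor hW
    ⟨fun w => {(w : V)}, fun w => connSet_iff.1 (connSet_singleton _), ?_, ?_⟩
  · intro w w' hne
    simpa using fun h => hne (Subtype.ext h)
  · intro w w' hadj
    exact touch_singletons hadj

end NewObs

/-! ### Parts attached at one vertex -/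

lemma pseudoforestOn_of_not_hasCycle (h : ¬ HasCycle G S) : PseudoforestOn G S :=
  fun u _ c _ hc _ hcS _ _ _ => absurd ⟨u, c, hc, hcS⟩ h

lemma HasCycle.exists_ne (h : HasCycle G S) (a b : V) : ∃ d ∈ S, d ≠ a ∧ d ≠ b := by
  obtain ⟨u, c, hc, hcS⟩ := h
  obtain ⟨p, hp, q, hq, hpq, hup, huq⟩ := exists_two_adj_of_mem_cycle hc c.start_mem_support
  have hu := hcS u c.start_mem_support
  have := hup.ne
  have := huq.ne
  have := hcS p hp
  have := hcS q hq
  grind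

/-- All edges of `G` leaving `A` end in `x`. -/
def Attached (G : SimpleGraph V) (A : Set V) (x : V) : Prop :=
  ∀ a ∈ A, ∀ b, G.Adj a b → b ∈ insert x A

lemma Attached.pseudoforestOn_union (hA : Attached G A x) (hSA : Disjoint S A)
    (hTA : T ⊆ insert x A) (hx : x ∈ S ↔ x ∈ T) (hS : PseudoforestOn G S)
    (hT : PseudoforestOn G T) (hc : x ∈ S → CycleAt G S x → ¬ CycleAt G T x) :
    PseudoforestOn G (S ∪ T) := by
  refine hS.union hT (x := x) ?_ ?_ fun h _ => hc h
  · rintro w ⟨hw, hwT⟩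
    exact (hTA hwT).resolve_right (Set.disjoint_left.1 hSA hw)
  · rintro a ⟨ha, haT⟩ b ⟨hb, hbS⟩ hab
    rcases hTA hb with rfl | hbA
    · exact hbS (hx.2 hb)
    · rcases hA b hbA a hab.symm with rfl | haA
      · exact haT (hx.1 ha)
      · exact Set.disjoint_left.1 hSA ha haA

lemma Attached.pseudoforestOn_compl (hA : Attached G A x) (hx : x ∉ A) {s : Set V}
    (h : PseudoforestOn G (Aᶜ \ s)) (h' : PseudoforestOn G (insert x A \ s))
    (hc : x ∉ s → CycleAt G (Aᶜ \ s) x → ¬ CycleAt G (insert x A \ s) x) :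
    PseudoforestOn G sᶜ := by
  refine (hA.pseudoforestOn_union ?_ Set.sdiff_subset ?_ h h' fun h1 => hc h1.2).mono ?_
  · exact disjoint_compl_left.mono_left Set.sdiff_subset
  · simp [hx]
  · intro w hw
    by_cases hwA : w ∈ A
    · exact Or.inr ⟨Or.inr hwA, hw⟩
    · exact Or.inl ⟨hwA, hw⟩

namespace NewObs

lemma hasCycle_insert [Finite V] (h : NewObs G) (hA : Attached G A x) (hx : x ∉ A)
    (hne : A.Nonempty) : HasCycle G (insert x A) := by
  by_contra hcyc
  obtain ⟨s, hs, hPF⟩ := h.apex_of_ne_univ (W := Aᶜ) (by simpa using hne.ne_empty)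
  have hT : ¬ HasCycle G (insert x A \ s) := fun h => hcyc (h.mono Set.sdiff_subset)
  exact h.not_pseudoforestOn_compl hs (hA.pseudoforestOn_compl hx hPF
    (pseudoforestOn_of_not_hasCycle hT) fun _ _ h => hT (HasCycle.mono h comp_subset))

lemma connSet_univ [Finite V] (h : NewObs G) : ConnSet G Set.univ := by
  have key : ∀ K : Set V, K.Nonempty → (∀ a ∈ K, ∀ b ∉ K, ¬ G.Adj a b) →
      ¬ PseudoforestOn G K := by
    intro K ⟨a, ha⟩ hK hPF
    obtain ⟨s, hs, hPF'⟩ := h.apex_of_ne_univ (W := Kᶜ)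
      (by simpa using Set.Nonempty.ne_empty ⟨a, ha⟩)
    refine h.not_pseudoforestOn_compl hs ((hPF.union hPF' (x := a) ?_ ?_ ?_).mono ?_)
    · rintro w ⟨hw, hw', -⟩
      exact absurd hw hw'
    · rintro a ⟨ha, -⟩ b ⟨hb, -⟩
      exact hK a ha b hb.1
    · intro _ h
      exact absurd ha h.1
    · intro w hw
      by_cases hwK : w ∈ K
      · exact Or.inl hwK
      · exact Or.inr ⟨hwK, hw⟩
  have hne : Nonempty V := by
    by_contra hne
    rw [not_nonempty_iff] at hne
    exact h.not_pseudoforestOn_univ fun u => isEmptyElim u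
  obtain ⟨a⟩ := hne
  refine connSet_of_forall (Set.mem_univ a) fun b _ => ?_
  by_contra hb
  have hcl : ∀ u ∈ comp G Set.univ a, ∀ v ∉ comp G Set.univ a, ¬ G.Adj u v :=
    fun u hu v hv huv => hv (comp_closed hu huv (Set.mem_univ v))
  refine key (comp G Set.univ a)ᶜ ⟨b, fun hb' => hb (ReachIn.symm hb')⟩ ?_
    (h.not_pseudoforestOn_disjoint disjoint_compl_right
      (key _ ⟨a, mem_comp_self (Set.mem_univ a)⟩ hcl))
  intro u hu v hv huv
  exact hcl v (not_not.1 hv) u hu huv.symm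

/-- The graph obtained from `G` by keeping the edges inside `insert x A` and adding the triangle
`x p q`. -/
def triangleGraph (G : SimpleGraph V) (A : Set V) (x p q : V) : SimpleGraph V :=
  SimpleGraph.fromRel fun a b => (G.Adj a b ∧ a ∈ insert x A ∧ b ∈ insert x A) ∨
    (a = x ∧ b = p) ∨ (a = x ∧ b = q) ∨ (a = p ∧ b = q)

lemma isMinorOf_triangleGraph {X P Q : Set V} {p q : V} (hx : x ∉ A)
    (hT : Tripod G Aᶜ X P Q) (hxX : x ∈ X) (hp : p ∈ P) (hq : q ∈ Q) :
    IsMinorOf ((triangleGraph G A x p q).induce (insert p (insert q (insert x A)))) G := by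
  classical
  let g : V → V := fun z => if z ∈ X then x else if z ∈ P then p else if z ∈ Q then q else z
  have hPX : ∀ z ∈ P, z ∉ X := fun z hz hz' => Set.disjoint_left.1 hT.disj₁₂ hz' hz
  have hQX : ∀ z ∈ Q, z ∉ X := fun z hz hz' => Set.disjoint_left.1 hT.disj₁₃ hz' hz
  have hQP : ∀ z ∈ Q, z ∉ P := fun z hz hz' => Set.disjoint_left.1 hT.disj₂₃ hz' hz
  have hcompl : ∀ z, z ∉ A ↔ z ∈ X ∨ z ∈ P ∨ z ∈ Q := by
    intro z
    rw [← Set.mem_compl_iff, ← hT.union, Set.mem_union, Set.mem_union, or_assoc]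
  have hgX : {z | g z = x} = X := by ext z; grind
  have hgP : {z | g z = p} = P := by ext z; grind
  have hgQ : {z | g z = q} = Q := by ext z; grind
  have hgA : ∀ w ∈ A, {z | g z = w} = {w} := by intro w hw; ext z; grind
  have hself : ∀ w ∈ insert x A, g w = w := by grind
  have htouch : ∀ w w', ((G.Adj w w' ∧ w ∈ insert x A ∧ w' ∈ insert x A) ∨
      (w = x ∧ w' = p) ∨ (w = x ∧ w' = q) ∨ (w = p ∧ w' = q)) →
      Touch G {z | g z = w} {z | g z = w'} := by
    rintro w w' (⟨hadj, hw, hw'⟩ | ⟨rfl, rfl⟩ | ⟨rfl, rfl⟩ | ⟨rfl, rfl⟩)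
    · exact ⟨w, hself w hw, w', hself w' hw', hadj⟩
    · rw [hgX, hgP]
      exact hT.touch₁₂
    · rw [hgX, hgQ]
      exact hT.touch₁₃
    · rw [hgP, hgQ]
      exact hT.touch₂₃
  refine ⟨fun w => {z | g z = w}, ?_, ?_, ?_⟩
  · rintro ⟨w, hw⟩
    refine connSet_iff.1 (?_ : ConnSet G {z | g z = w})
    rcases hw with rfl | rfl | rfl | hw
    · exact hgP ▸ hT.conn₂
    · exact hgQ ▸ hT.conn₃
    · exact hgX ▸ hT.conn₁
    · exact hgA w hw ▸ connSet_singleton w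
  · intro w w' hne
    rw [Set.disjoint_left]
    intro z hz hz'
    exact hne (Subtype.ext (hz.symm.trans hz'))
  · rintro w w' ⟨-, h | h⟩
    · exact htouch _ _ h
    · exact (htouch _ _ h).symm

/-- The part outside `A` can be replaced by a triangle if it is a pseudoforest with a cycle. -/
lemma false_of_attached [Finite V] (h : NewObs G) (hA : Attached G A x) (hx : x ∉ A)
    (hconn : ConnSet G Aᶜ) (hPF : PseudoforestOn G Aᶜ) (hcyc : HasCycle G Aᶜ)
    (hcard : ∀ p q, ∃ d ∉ A, d ≠ x ∧ d ≠ p ∧ d ≠ q) : False := by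
  obtain ⟨X, P, Q, hT, hxX⟩ := exists_tripod hconn hx hcyc
  obtain ⟨p, hp⟩ := hT.conn₂.1
  obtain ⟨q, hq⟩ := hT.conn₃.1
  have hpx : p ≠ x := fun h => Set.disjoint_left.1 hT.disj₁₂ hxX (h ▸ hp)
  have hqx : q ≠ x := fun h => Set.disjoint_left.1 hT.disj₁₃ hxX (h ▸ hq)
  have hpq : p ≠ q := fun h => Set.disjoint_left.1 hT.disj₂₃ hp (h ▸ hq)
  have hpA : p ∉ A := hT.subset₂ hp
  have hqA : q ∉ A := hT.subset₃ hq
  obtain ⟨d, hd⟩ := hcard p q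
  obtain ⟨s, hs, hs'⟩ := h.apex_of_minor (W := insert p (insert q (insert x A)))
    (fun h => by have := h.symm.subset (Set.mem_univ d); grind)
    (isMinorOf_triangleGraph hx hT hxX hp hq)
  set K := triangleGraph G A x p q with hK
  have hGK : ∀ u ∈ insert x A, ∀ v ∈ insert x A, G.Adj u v → K.Adj u v :=
    fun u hu v hv huv => ⟨huv.ne, Or.inl (Or.inl ⟨huv, hu, hv⟩)⟩
  by_cases hsA : ∃ v ∈ s, v ∈ A
  · obtain ⟨v, hvs, hvA⟩ := hsA
    obtain rfl : s = {v} := hs.eq_singleton_of_mem hvs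
    have hxv : x ≠ v := fun h => hx (h ▸ hvA)
    refine h.not_pseudoforestOn_compl hs (hA.pseudoforestOn_compl hx
      (hPF.mono Set.sdiff_subset) ?_ ?_)
    · refine (hs'.mono (Set.sdiff_subset_sdiff_left ?_)).of_adj_imp
        fun u hu v hv => hGK u hu.1 v hv.1
      exact fun w hw => Or.inr (Or.inr hw)
    · intro _ _ hc
      have hZ := connSet_comp (G := G) (S := insert x A \ {v}) (a := x) ⟨Or.inl rfl, hxv⟩
      set Z := comp G (insert x A \ {v}) x with hZdef
      have hZs : Z ⊆ insert x A \ {v} := comp_subset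
      have hxZ : x ∈ Z := mem_comp_self ⟨Or.inl rfl, hxv⟩
      have hZK : ConnSet K Z := ⟨hZ.1, fun a ha b hb => (hZ.2 a ha b hb).map_graph
        fun u hu v hv => hGK u (hZs hu).1 v (hZs hv).1⟩
      have h₁ : K.Adj x p := ⟨hpx.symm, by simp⟩
      have h₂ : K.Adj p q := ⟨hpq, by simp⟩
      have h₃ : K.Adj q x := ⟨hqx, by simp⟩
      have hU : ConnSet K (Z ∪ ({x} ∪ {p} ∪ {q})) :=
        hZK.union (((connSet_singleton x).union_of_touch (connSet_singleton p)
          (touch_singletons h₁)).union_of_touch (connSet_singleton q)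
          ((touch_singletons h₂).mono Set.subset_union_right subset_rfl)) ⟨x, hxZ, by simp⟩
      refine not_pseudoforestOn hU (S := Z) (T := {x} ∪ {p} ∪ {q})
        (HasCycle.map_graph hc fun u hu v hv => hGK u (hZs hu).1 v (hZs hv).1)
        (hasCycle_of_triangle h₁ h₂ h₃ (by simp) (by simp) (by simp)) Set.subset_union_left
        Set.subset_union_right ?_ (hs'.mono ?_)
      · refine (Set.subsingleton_singleton (a := x)).anti ?_
        rintro w ⟨hw, (rfl | rfl) | rfl⟩
        · rfl
        · exact absurd (hZs hw).1 (by grind)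
        · exact absurd (hZs hw).1 (by grind)
      · have : p ≠ v := fun h => hpA (h ▸ hvA)
        have : q ≠ v := fun h => hqA (h ▸ hvA)
        rintro w (hw | (rfl | rfl) | rfl)
        · exact ⟨Or.inr (Or.inr (hZs hw).1), (hZs hw).2⟩
        all_goals simp_all
  · push Not at hsA
    refine h.not_pseudoforestOn_compl_singleton x (hA.pseudoforestOn_compl hx
      (hPF.mono Set.sdiff_subset) ?_ fun h => absurd rfl h)
    refine (hs'.mono (S := A) fun w hw => ⟨?_, fun h => hsA w h hw⟩).of_adj_imp
        (fun u hu v hv => hGK u (Or.inr hu) v (Or.inr hv)) |>.mono ?_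
    · exact Or.inr (Or.inr (Or.inr hw))
    · rintro w ⟨rfl | hw, hwx⟩
      · exact absurd rfl hwx
      · exact hw

end NewObs

/-! ### Decompositions along two cut-vertices -/

lemma ConnSet.diff_attached (hS : ConnSet G S) (hC : Attached G C y) (hy : y ∈ S) (hyC : y ∉ C) :
    ConnSet G (S \ C) := by
  refine ⟨⟨y, hy, hyC⟩, fun a ha b hb => ?_⟩
  refine (((hS.2 a ha.1 b hb.1).mono ?_).retract (x := y) (T := insert y C) ?_ ?_ ha).1 hb
  · intro w hw
    by_cases hwC : w ∈ C
    · exact Or.inr (Or.inr hwC)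
    · exact Or.inl ⟨hw, hwC⟩
  · rintro w ⟨hw, hw' | hw'⟩
    · exact hw'
    · exact absurd hw' hw.2
  · rintro a ⟨ha, haT⟩ b ⟨hb | hb, hbS⟩ hab
    · exact hbS (hb ▸ ⟨hy, hyC⟩)
    · exact haT (hC b hb a hab.symm)

/-- Two disjoint parts `A`, `C` attached at distinct vertices `x`, `y`, the remaining vertices
forming a connected set containing `x` and `y`. -/
structure Dec (G : SimpleGraph V) (A : Set V) (x : V) (C : Set V) (y : V) : Prop where
  ne : x ≠ y
  xA : x ∉ A
  xC : x ∉ C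
  yA : y ∉ A
  yC : y ∉ C
  nonemptyA : A.Nonempty
  nonemptyC : C.Nonempty
  disj : Disjoint A C
  connA : ConnSet G (insert x A)
  connC : ConnSet G (insert y C)
  attA : Attached G A x
  attC : Attached G C y
  connB : ConnSet G (A ∪ C)ᶜ

lemma exists_comp_of_cutVertex [Finite V] (hG : ConnSet G Set.univ) (hx : CutVertex G x) (y : V) :
    ∃ a, a ≠ x ∧ y ∉ comp G (Set.univ \ {x}) a := by
  by_contra! hcon
  have hGc : G.Connected := by
    rw [connected_iff_exists_forall_reachable]
    obtain ⟨⟨a, -⟩, h⟩ := hG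
    refine ⟨a, fun b => ?_⟩
    obtain ⟨p, -⟩ := h a trivial b trivial
    exact ⟨p⟩
  have hpre : (G.induce ({x}ᶜ : Set V)).Preconnected := by
    by_cases hne : ∃ a, a ≠ x
    · obtain ⟨a, ha⟩ := hne
      have hya := hcon a ha
      have : ConnSet G ({x}ᶜ : Set V) := by
        rw [Set.compl_eq_univ_sdiff]
        exact connSet_of_forall hya.right_mem fun b hb => hcon b hb.2
      exact (connSet_iff.1 this).preconnected
    · push Not at hne
      exact fun a => absurd (hne a) a.2
  have := hpre.subsingleton_connectedComponent
  have h1 := Finite.card_le_one_iff_subsingleton.2 this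
  have := hGc.nonempty
  have h2 : 0 < Nat.card G.ConnectedComponent := Nat.card_pos
  have h3 : Nat.card G.ConnectedComponent < _ := hx
  omega

lemma connSet_insert_comp (h : ConnSet G S) (hx : x ∈ S) (ha : a ∈ S) (hax : a ≠ x) :
    ConnSet G (insert x (comp G (S \ {x}) a)) := by
  rw [← Set.union_singleton]
  exact (connSet_comp (show a ∈ S \ {x} from ⟨ha, hax⟩)).union_of_touch (connSet_singleton x)
    (touch_comp (h.2 a ha x hx) hax)

lemma exists_dec [Finite V] (hG : ConnSet G Set.univ) (hx : CutVertex G x) (hy : CutVertex G y)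
    (hxy : x ≠ y) : ∃ A C, Dec G A x C y := by
  obtain ⟨a, hax, hya⟩ := exists_comp_of_cutVertex hG hx y
  obtain ⟨c, hcy, hxc⟩ := exists_comp_of_cutVertex hG hy x
  have att : ∀ x a, Attached G (comp G (Set.univ \ {x}) a) x := by
    intro x a b hb z hbz
    by_cases hz : z = x
    · exact Or.inl hz
    · exact Or.inr (comp_closed hb hbz ⟨trivial, hz⟩)
  have hxA : x ∉ comp G (Set.univ \ {x}) a := fun h => h.right_mem.2 rfl
  have hyC : y ∉ comp G (Set.univ \ {y}) c := fun h => h.right_mem.2 rfl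
  have hA := connSet_insert_comp hG trivial (Set.mem_univ a) hax
  refine ⟨_, _, hxy, hxA, hxc, hya, hyC, ⟨a, mem_comp_self ⟨trivial, hax⟩⟩,
    ⟨c, mem_comp_self ⟨trivial, hcy⟩⟩, ?_, hA,
    connSet_insert_comp hG trivial (Set.mem_univ c) hcy, att x a, att y c, ?_⟩
  · rw [Set.disjoint_left]
    intro w hw hwC
    refine hxc (ReachIn.trans hwC ((hA.2 w (Or.inr hw) x (Or.inl rfl)).mono ?_))
    rintro z (rfl | hz)
    · exact ⟨trivial, hxy⟩
    · refine ⟨trivial, ?_⟩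
      rintro rfl
      exact hya hz
  · rw [Set.compl_union, Set.compl_eq_univ_sdiff, ← Set.sdiff_eq]
    exact (hG.diff_attached (att x a) trivial hxA).diff_attached (att y c) ⟨trivial, hya⟩ hyC

namespace Dec

lemma symm (h : Dec G A x C y) : Dec G C y A x :=
  ⟨h.ne.symm, h.yC, h.yA, h.xC, h.xA, h.nonemptyC, h.nonemptyA, h.disj.symm, h.connC, h.connA,
    h.attC, h.attA, Set.union_comm A C ▸ h.connB⟩

lemma memB₁ (h : Dec G A x C y) : x ∈ (A ∪ C)ᶜ := fun hx => hx.elim h.xA h.xC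

lemma memB₂ (h : Dec G A x C y) : y ∈ (A ∪ C)ᶜ := fun hy => hy.elim h.yA h.yC

lemma disjoint_insert (h : Dec G A x C y) : Disjoint (insert x A) (insert y C) := by
  simp [h.disj, h.ne.symm, h.xC, h.yA]

/-- The middle part is as small as possible. -/
def Minimal (G : SimpleGraph V) (A C : Set V) : Prop :=
  ∀ A' x' C' y', Dec G A' x' C' y' → (A ∪ C)ᶜ.ncard ≤ (A' ∪ C')ᶜ.ncard

lemma exists_minimal (h : Dec G A x C y) : ∃ A x C y, Dec G A x C y ∧ Minimal G A C := by
  let f : Set V × V × Set V × V → ℕ := fun t => (t.1 ∪ t.2.2.1)ᶜ.ncard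
  let D : Set (Set V × V × Set V × V) := {t | Dec G t.1 t.2.1 t.2.2.1 t.2.2.2}
  obtain ⟨t, ht, hmin⟩ := (measure f).wf.has_min D ⟨(A, x, C, y), h⟩
  exact ⟨_, _, _, _, ht, fun A' x' C' y' h' => not_lt.1 (hmin (A', x', C', y') h')⟩

lemma reachIn_of_minimal [Finite V] (h : Dec G A x C y) (hmin : Minimal G A C) {s : V}
    (hs : s ∈ (A ∪ C)ᶜ) (hsx : s ≠ x) (hsy : s ≠ y) : ReachIn G ((A ∪ C)ᶜ \ {s}) x y := by
  by_contra hcon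
  set B := (A ∪ C)ᶜ with hB
  set K := comp G (B \ {s}) x with hK
  have hyK : y ∉ K := hcon
  have hxK : x ∈ K := mem_comp_self ⟨h.memB₁, hsx.symm⟩
  have hKB : K ⊆ B \ {s} := comp_subset
  have hsK : s ∉ K := fun h => (hKB h).2 rfl
  have hyB : y ∈ B := h.memB₂
  have hBA : ∀ b ∈ B, b ∉ A := fun b hb hbA => hb (Or.inl hbA)
  have hBC : ∀ b ∈ B, b ∉ C := fun b hb hbC => hb (Or.inr hbC)
  have hcover : ∀ b, b ∈ A ∨ b ∈ C ∨ b ∈ B := fun b => by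
    by_cases hb : b ∈ A ∪ C
    · exact hb.imp_right Or.inl
    · exact Or.inr (Or.inr hb)
  have hAC := Set.disjoint_left.1 h.disj
  set C' := C ∪ (B \ insert s K) with hC'
  have hB' : (A ∪ C')ᶜ = K ∪ {s} := by
    ext b
    have := hcover b
    have : b ∈ K → b ∈ B \ {s} := fun hb => hKB hb
    grind
  have hdec : Dec G A x C' s := by
    refine ⟨hsx.symm, h.xA, ?_, hBA s hs, ?_, h.nonemptyA, h.nonemptyC.mono Set.subset_union_left,
      ?_, h.connA, ?_, h.attA, ?_, ?_⟩
    · rintro (hx | hx)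
      · exact h.xC hx
      · exact hx.2 (Or.inr hxK)
    · rintro (hx | hx)
      · exact hBC s hs hx
      · exact hx.2 (Or.inl rfl)
    · exact Set.disjoint_union_right.2 ⟨h.disj, Set.disjoint_left.2 fun a ha hb => hBA a hb.1 ha⟩
    · have : insert s C' = (B \ K) ∪ insert y C := by
        ext b
        grind
      rw [this]
      exact (h.connB.diff_comp hs).union h.connC ⟨y, ⟨hyB, hyK⟩, Or.inl rfl⟩
    · rintro a (ha | ⟨haB, haK⟩) b hab
      · rcases h.attC a ha b hab with rfl | hb
        · exact Or.inr (Or.inr ⟨hyB, by simp [hyK, hsy.symm]⟩)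
        · exact Or.inr (Or.inl hb)
      · rcases hcover b with hb | hb | hb
        · rcases h.attA b hb a hab.symm with rfl | haA
          · exact absurd (Or.inr hxK) haK
          · exact absurd haA (hBA a haB)
        · exact Or.inr (Or.inl hb)
        · by_cases hbs : b = s
          · exact Or.inl hbs
          · refine Or.inr (Or.inr ⟨hb, ?_⟩)
            rintro (hbs' | hbK)
            · exact hbs hbs'
            · exact haK (Or.inr (comp_closed hbK hab.symm ⟨haB, fun h => haK (Or.inl h)⟩))
    · rw [hB']
      exact (connSet_comp (show x ∈ B \ {s} from ⟨h.memB₁, hsx.symm⟩)).union_of_touch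
        (connSet_singleton s)
        (touch_comp (h.connB.2 x h.memB₁ s hs) hsx.symm)
  refine absurd (hmin _ _ _ _ hdec) (not_le.2 (Set.ncard_lt_ncard ?_ (Set.toFinite _)))
  rw [hB', Set.ssubset_iff_of_subset]
  · exact ⟨y, hyB, by simp [hyK, hsy.symm]⟩
  · exact Set.union_subset (hKB.trans Set.sdiff_subset) (Set.singleton_subset_iff.2 hs)

end Dec

lemma pseudoforestOn_of_comp (h : ¬ HasCycle G (comp G S x))
    (hS : PseudoforestOn G (S \ comp G S x)) : PseudoforestOn G S := by
  refine (hS.union (pseudoforestOn_of_not_hasCycle h) (x := x) ?_ ?_ fun _ _ _ h' =>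
    h (HasCycle.mono h' comp_subset)).mono ?_
  · rintro w ⟨hw, hw'⟩
    exact absurd hw' hw.2
  · rintro a ⟨ha, -⟩ b ⟨hb, -⟩ hab
    exact ha.2 (comp_closed hb hab.symm ha.1)
  · intro w hw
    rw [Set.sdiff_union_self]
    exact Or.inl hw

lemma CycleAt.exists_comp (h : CycleAt G S x) : ∃ d ∈ S \ {x},
    Touch G (comp G (S \ {x}) d) {x} ∧ HasCycle G (insert x (comp G (S \ {x}) d)) := by
  have h' := h
  obtain ⟨u, c, hc, hcS⟩ := h'
  have hd : ∃ d ∈ c.support, d ≠ x := by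
    obtain ⟨a, ha, b, hb, hab, -⟩ := exists_two_adj_of_mem_cycle hc c.start_mem_support
    by_cases hax : a = x
    · exact ⟨b, hb, fun hbx => hab (hax.trans hbx.symm)⟩
    · exact ⟨a, ha, hax⟩
  obtain ⟨d, hd, hdx⟩ := hd
  refine ⟨d, ⟨(hcS d hd).right_mem, hdx⟩, touch_comp (ReachIn.symm (hcS d hd)) hdx, u, c, hc, ?_⟩
  intro w hw
  by_cases hwx : w = x
  · exact Or.inl hwx
  · refine Or.inr ((reachIn_cycle_diff hc hd hw hdx hwx).mono fun z hz => ⟨?_, hz.2⟩)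
    exact (hcS z hz.1).right_mem

namespace Dec

variable [Finite V]

lemma pseudoforestOn (h : Dec G A x C y) (hG : NewObs G) : PseudoforestOn G A := by
  by_contra hA
  have hcyc := hG.hasCycle_insert h.attC h.yC h.nonemptyC
  have hsub : insert y C ⊆ Aᶜ := fun w hw hwA =>
    Set.disjoint_left.1 h.disjoint_insert (Or.inr hwA) hw
  have hcompl : Aᶜ = (A ∪ C)ᶜ ∪ insert y C := by
    ext w
    have : w ∈ A → w ∉ C := fun hw => Set.disjoint_left.1 h.disj hw
    have := h.yA
    grind
  refine hG.false_of_attached h.attA h.xA ?_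
    (hG.not_pseudoforestOn_disjoint disjoint_compl_right hA) (hcyc.mono hsub) fun p q => ?_
  · rw [hcompl]
    exact h.connB.union h.connC ⟨y, h.memB₂, Or.inl rfl⟩
  · obtain ⟨d, hd, hdp, hdq⟩ := hcyc.exists_ne p q
    refine ⟨d, hsub hd, ?_, hdp, hdq⟩
    rintro rfl
    exact Set.disjoint_left.1 h.disjoint_insert (Or.inl rfl) hd

lemma pseudoforestOn_insert (h : Dec G A x C y) (hG : NewObs G) :
    PseudoforestOn G (insert x A) := by
  by_contra hA
  refine hG.not_pseudoforestOn_compl_singleton x (h.attA.pseudoforestOn_compl h.xA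
    ((hG.not_pseudoforestOn_disjoint disjoint_compl_right hA).mono ?_)
    ((h.pseudoforestOn hG).mono ?_) fun h => absurd rfl h)
  · rintro w ⟨hw, hwx⟩ (rfl | hw')
    · exact hwx rfl
    · exact hw hw'
  · rintro w ⟨rfl | hw, hwx⟩
    · exact absurd rfl hwx
    · exact hw

lemma cycleAt (h : Dec G A x C y) (hG : NewObs G) : CycleAt G ((A ∪ C)ᶜ \ {x}) y := by
  by_contra hcon
  set B := (A ∪ C)ᶜ with hB
  have hyB : y ∈ B \ {x} := ⟨h.memB₂, h.ne.symm⟩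
  have hBx : ¬ PseudoforestOn G (B \ {x}) := by
    intro hPF
    have h1 : PseudoforestOn G (B \ {x} ∪ insert y C) := by
      refine h.attC.pseudoforestOn_union ?_ subset_rfl (iff_of_true hyB (Or.inl rfl)) hPF
        (h.symm.pseudoforestOn_insert hG) fun _ h => absurd h hcon
      exact Set.disjoint_left.2 fun w hw hwC => hw.1 (Or.inr hwC)
    refine hG.not_pseudoforestOn_compl_singleton x (h.attA.pseudoforestOn_compl h.xA
      (h1.mono ?_) ((h.pseudoforestOn_insert hG).mono Set.sdiff_subset) fun h => absurd rfl h)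
    rintro w ⟨hw, hwx⟩
    by_cases hwC : w ∈ C
    · exact Or.inr (Or.inr hwC)
    · exact Or.inl ⟨fun h => h.elim hw hwC, hwx⟩
  set Y := comp G (B \ {x}) y with hY
  have hyY : y ∈ Y := mem_comp_self hyB
  have hYB : Y ⊆ B \ {x} := comp_subset
  have hR : ¬ PseudoforestOn G ((B \ {x}) \ Y) := fun hR => hBx (pseudoforestOn_of_comp hcon hR)
  have hM : ConnSet G (insert x A ∪ (Y ∪ insert y C)) := by
    refine h.connA.union_of_touch ((connSet_comp hyB).union h.connC ⟨y, hyY, Or.inl rfl⟩) ?_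
    exact (touch_comp (h.connB.2 y h.memB₂ x h.memB₁) h.ne.symm).symm.mono (by simp)
      Set.subset_union_left
  refine not_pseudoforestOn hM (hG.hasCycle_insert h.attA h.xA h.nonemptyA)
    (hG.hasCycle_insert h.attC h.yC h.nonemptyC) Set.subset_union_left
    (Set.subset_union_right.trans Set.subset_union_right) ?_
    (hG.not_pseudoforestOn_disjoint (Set.disjoint_left.2 ?_) hR)
  · rw [Set.disjoint_iff_inter_eq_empty.1 h.disjoint_insert]
    exact Set.subsingleton_empty
  · rintro w ⟨hw, hwY⟩ ((rfl | hwA) | hwY' | rfl | hwC)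
    · exact hw.2 rfl
    · exact hw.1 (Or.inl hwA)
    · exact hwY hwY'
    · exact hwY hyY
    · exact hw.1 (Or.inr hwC)

end Dec

/-- A connected piece of the middle part of a decomposition which is adjacent to both cut-vertices
and forms a cycle with each of them. -/
structure Core (G : SimpleGraph V) (A : Set V) (x : V) (C : Set V) (y : V) (K : Set V) : Prop where
  subset : K ⊆ ((A ∪ C)ᶜ \ {x}) \ {y}
  conn : ConnSet G K
  closed : ∀ a ∈ K, ∀ b ∈ ((A ∪ C)ᶜ \ {x}) \ {y}, G.Adj a b → b ∈ K
  touch₁ : Touch G K {x}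
  touch₂ : Touch G K {y}
  cycle₁ : HasCycle G (insert x K)
  cycle₂ : HasCycle G (insert y K)

lemma Dec.not_pseudoforestOn_union [Finite V] (h : Dec G A x C y) (hG : NewObs G) {K : Set V}
    (hK : ConnSet G K) (ht : Touch G K {x}) (hc : HasCycle G (insert x K)) (hKA : Disjoint K A) :
    ¬ PseudoforestOn G (insert x A ∪ K) := by
  refine not_pseudoforestOn (h.connA.union_of_touch hK (ht.symm.mono (by simp) subset_rfl))
    (hG.hasCycle_insert h.attA h.xA h.nonemptyA) hc Set.subset_union_left ?_ ?_
  · exact Set.insert_subset (Or.inl (Or.inl rfl)) Set.subset_union_right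
  · refine (Set.subsingleton_singleton (a := x)).anti ?_
    rintro w ⟨hw | hw, hw' | hw'⟩
    · exact hw
    · exact hw
    · exact hw'
    · exact absurd hw (Set.disjoint_left.1 hKA hw')

lemma Dec.exists_core [Finite V] (h : Dec G A x C y) (hG : NewObs G) :
    ∃ K, Core G A x C y K := by
  have h₁ : CycleAt G ((A ∪ C)ᶜ \ {y}) x := by
    rw [Set.union_comm]
    exact h.symm.cycleAt hG
  obtain ⟨d, hd, hdx, hdc⟩ := h₁.exists_comp
  obtain ⟨e, he, hey, hec⟩ := (h.cycleAt hG).exists_comp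
  rw [Set.sdiff_sdiff_comm] at hd hdx hdc
  set B₀ := ((A ∪ C)ᶜ \ {x}) \ {y} with hB₀
  have hdB : comp G B₀ d ⊆ B₀ := comp_subset
  have heB : comp G B₀ e ⊆ B₀ := comp_subset
  by_cases hde : e ∈ comp G B₀ d
  · have heq : comp G B₀ e = comp G B₀ d := by
      ext w
      exact ⟨fun hw => ReachIn.trans hde hw, fun hw => (ReachIn.symm hde).trans hw⟩
    rw [heq] at hey hec
    exact ⟨comp G B₀ d, hdB, connSet_comp hd, fun a ha b hb hab => comp_closed ha hab hb, hdx, hey,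
      hdc, hec⟩
  · have hdisj : Disjoint (comp G B₀ d) (comp G B₀ e) :=
      Set.disjoint_left.2 fun w hw hw' => hde (ReachIn.trans hw (ReachIn.symm hw'))
    have hA : Disjoint (comp G B₀ d) A :=
      Set.disjoint_left.2 fun w hw hwA => (hdB hw).1.1 (Or.inl hwA)
    have hC : Disjoint (comp G B₀ e) C :=
      Set.disjoint_left.2 fun w hw hwC => (heB hw).1.1 (Or.inr hwC)
    refine absurd (hG.not_pseudoforestOn_disjoint ?_
      (h.not_pseudoforestOn_union hG (connSet_comp hd) hdx hdc hA))
      (h.symm.not_pseudoforestOn_union hG (connSet_comp he) hey hec hC)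
    rw [Set.disjoint_union_left, Set.disjoint_union_right, Set.disjoint_union_right]
    refine ⟨⟨h.disjoint_insert, Set.disjoint_left.2 ?_⟩, Set.disjoint_left.2 ?_, hdisj⟩
    · rintro w (rfl | hw) hw'
      · exact (heB hw').1.2 rfl
      · exact (heB hw').1.1 (Or.inl hw)
    · rintro w hw' (rfl | hw)
      · exact (hdB hw').2 rfl
      · exact (hdB hw').1.1 (Or.inr hw)

/-! ### Fans -/

/-- Two disjoint connected subsets of `M` avoiding `v`, each meeting `N` and adjacent to `v`. -/
def FanAt (G : SimpleGraph V) (M N : Set V) (v : V) : Prop :=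
  ∃ U W, ConnSet G U ∧ ConnSet G W ∧ Disjoint U W ∧ U ⊆ M \ {v} ∧ W ⊆ M \ {v} ∧
    (U ∩ N).Nonempty ∧ (W ∩ N).Nonempty ∧ Touch G U {v} ∧ Touch G W {v}

lemma ConnSet.exists_trim (hS : ConnSet G S) (hv : v ∈ S) (hN : (S ∩ N).Nonempty) (hvN : v ∉ N) :
    ∃ S' ⊆ S \ {v}, ConnSet G S' ∧ (S' ∩ N).Nonempty ∧ Touch G S' {v} := by
  obtain ⟨n, hn, hnN⟩ := hN
  have hnv : n ≠ v := fun h => hvN (h ▸ hnN)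
  have hmem : n ∈ S \ {v} := ⟨hn, hnv⟩
  exact ⟨comp G (S \ {v}) n, comp_subset, connSet_comp hmem, ⟨n, mem_comp_self hmem, hnN⟩,
    touch_comp (hS.2 n hn v hv) hnv⟩

lemma exists_connSet_disjoint_or (hR : ConnSet G R) (hU : ConnSet G U) (hW : ConnSet G W)
    (hd : Disjoint U W) (hv : v ∈ R) (hRN : (R ∩ N).Nonempty) (hUN : (U ∩ N).Nonempty)
    (hWN : (W ∩ N).Nonempty) :
    ∃ S ⊆ R ∪ U ∪ W, ConnSet G S ∧ v ∈ S ∧ (S ∩ N).Nonempty ∧ (Disjoint S U ∨ Disjoint S W) := by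
  by_cases hvU : v ∈ U
  · exact ⟨U, fun w hw => Or.inl (Or.inr hw), hU, hvU, hUN, Or.inr hd⟩
  by_cases hvW : v ∈ W
  · exact ⟨W, fun w hw => Or.inr hw, hW, hvW, hWN, Or.inl hd.symm⟩
  have hmem : v ∈ R \ (U ∪ W) := ⟨hv, fun h => h.elim hvU hvW⟩
  set D := comp G (R \ (U ∪ W)) v with hD
  have hDR : D ⊆ R \ (U ∪ W) := comp_subset
  have hDU : Disjoint D U := Set.disjoint_left.2 fun w hw hwU => (hDR hw).2 (Or.inl hwU)
  have hDW : Disjoint D W := Set.disjoint_left.2 fun w hw hwW => (hDR hw).2 (Or.inr hwW)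
  have hDc : ConnSet G D := connSet_comp hmem
  have hvD : v ∈ D := mem_comp_self hmem
  by_cases hRD : R ⊆ D
  · exact ⟨R, fun w hw => Or.inl (Or.inl hw), hR, hv, hRN, Or.inl (hDU.mono_left hRD)⟩
  obtain ⟨a, ⟨-, ha⟩, b, ⟨hbR, hbD⟩, hab⟩ := hR.exists_touch ⟨v, hv, hvD⟩ hRD
  have hb : b ∈ U ∪ W := by
    by_contra hb
    exact hbD (comp_closed ha hab ⟨hbR, hb⟩)
  rcases hb with hb | hb
  · refine ⟨D ∪ U, ?_, hDc.union_of_touch hU ⟨a, ha, b, hb, hab⟩, Or.inl hvD,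
      hUN.mono fun w hw => ⟨Or.inr hw.1, hw.2⟩, Or.inr (Set.disjoint_union_left.2 ⟨hDW, hd⟩)⟩
    exact fun w hw => Or.inl (hw.imp_left fun h => (hDR h).1)
  · refine ⟨D ∪ W, ?_, hDc.union_of_touch hW ⟨a, ha, b, hb, hab⟩, Or.inl hvD,
      hWN.mono fun w hw => ⟨Or.inr hw.1, hw.2⟩, Or.inl (Set.disjoint_union_left.2 ⟨hDU, hd.symm⟩)⟩
    exact fun w hw => hw.imp_left fun h => Or.inl (hDR h).1

lemma FanAt.step (h : u ∈ N ∨ FanAt G M N u) (huM : u ∈ M) (huv : G.Adj u v) (hR : ConnSet G R)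
    (hRM : R ⊆ M) (hv : v ∈ R) (hu : u ∉ R) (hRN : (R ∩ N).Nonempty) :
    v ∈ N ∨ FanAt G M N v := by
  by_cases hvN : v ∈ N
  · exact Or.inl hvN
  have huv' : u ∈ M \ {v} := ⟨huM, huv.ne⟩
  refine Or.inr ?_
  rcases h with huN | ⟨U, W, hU, hW, hd, hUM, hWM, hUN, hWN, hUt, hWt⟩
  · obtain ⟨S', hS', hc, hN, ht⟩ := hR.exists_trim hv hRN hvN
    exact ⟨{u}, S', connSet_singleton u, hc,
      Set.disjoint_singleton_left.2 fun h => hu (hS' h).1, Set.singleton_subset_iff.2 huv',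
      hS'.trans (Set.sdiff_subset_sdiff_left hRM), ⟨u, rfl, huN⟩, hN, touch_singletons huv, ht⟩
  · have key : ∀ {U S}, ConnSet G U → U ⊆ M \ {u} → (U ∩ N).Nonempty → Touch G U {u} →
        ConnSet G S → S ⊆ M \ {u} → v ∈ S → (S ∩ N).Nonempty → Disjoint S U →
        FanAt G M N v := by
      intro U S hU hUM hUN hUt hS hSM hvS hSN hd
      obtain ⟨S', hS', hc, hN, ht⟩ := hS.exists_trim hvS hSN hvN
      refine ⟨S', U ∪ {u}, hc, hU.union_of_touch (connSet_singleton u) hUt, ?_, ?_, ?_, hN,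
        hUN.mono fun w hw => ⟨Or.inl hw.1, hw.2⟩, ht,
        (touch_singletons huv).mono Set.subset_union_right subset_rfl⟩
      · rw [Set.disjoint_union_right, Set.disjoint_singleton_right]
        exact ⟨hd.mono_left (hS'.trans Set.sdiff_subset), fun h => (hSM (hS' h).1).2 rfl⟩
      · exact fun w hw => ⟨(hSM (hS' hw).1).1, (hS' hw).2⟩
      · refine Set.union_subset (fun w hw => ⟨(hUM hw).1, ?_⟩) (Set.singleton_subset_iff.2 huv')
        rintro rfl
        exact Set.disjoint_left.1 hd hvS hw
    obtain ⟨S, hS, hSc, hvS, hSN, hd'⟩ := exists_connSet_disjoint_or hR hU hW hd hv hRN hUN hWN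
    have hSM : S ⊆ M \ {u} := by
      intro w hw
      rcases hS hw with (hw | hw) | hw
      · exact ⟨hRM hw, fun h => hu (h ▸ hw)⟩
      · exact hUM hw
      · exact hWM hw
    rcases hd' with hd' | hd'
    · exact key hU hUM hUN hUt hSc hSM hvS hSN hd'
    · exact key hW hWM hWN hWt hSc hSM hvS hSN hd'

/-- A case of Menger's theorem: if no single vertex other than `y` separates `N` from `y` in the
set `M`, then there is a fan at `y`. -/
lemma exists_fanAt (hyN : y ∉ N) (hM : ∃ n ∈ N, ReachIn G M n y)
    (h : ∀ w ∈ M, w ≠ y → ∃ n ∈ N, ReachIn G (M \ {w}) n y) : FanAt G M N y := by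
  classical
  have key : ∀ {u} (p : G.Walk u y), p.IsPath → (∀ w ∈ p.support, w ∈ M) →
      (u ∈ N ∨ FanAt G M N u) → FanAt G M N y := by
    intro u p
    induction p with
    | nil => exact fun _ _ h => h.resolve_left hyN
    | @cons u v y huv p ih =>
      intro hp hpM hu
      rw [Walk.cons_isPath_iff] at hp
      simp only [Walk.support_cons, List.mem_cons, forall_eq_or_imp] at hpM
      obtain ⟨n, hn, hny⟩ := h u hpM.1 fun h => hp.2 (h ▸ p.end_mem_support)
      have hnm : n ∈ M \ {u} := hny.left_mem
      refine ih hyN hM h hp.1 hpM.2 (FanAt.step hu hpM.1 huv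
        (R := comp G (M \ {u}) n ∪ {w | w ∈ p.support}) ?_ ?_ ?_ ?_ ?_)
      · refine (connSet_comp hnm).union ⟨⟨y, p.end_mem_support⟩, ?_⟩ ⟨y, hny, p.end_mem_support⟩
        exact fun a ha b hb => ReachIn.of_walk_mem ha hb
      · exact Set.union_subset (comp_subset.trans Set.sdiff_subset) hpM.2
      · exact Or.inr p.start_mem_support
      · exact fun h => h.elim (fun h => h.right_mem.2 rfl) hp.2
      · exact ⟨n, Or.inl (mem_comp_self hnm), hn⟩
  obtain ⟨n, hn, p, hp⟩ := hM
  exact key p.bypass p.bypass_isPath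
    (fun w hw => hp w (p.support_bypass_subset_support hw)) (Or.inl hn)

/-! ### Excluded configurations -/

lemma pairwise_disjoint_append {L L' L'' : List (Set V)} (hL : L.Pairwise Disjoint)
    (hL' : L'.Pairwise Disjoint) (hL'' : L''.Pairwise Disjoint) (hS : ∀ P ∈ L, P ⊆ S)
    (hT : ∀ P ∈ L', P ⊆ T) (hU : ∀ P ∈ L'', P ⊆ U) (dST : Disjoint S T) (dSU : Disjoint S U)
    (dTU : Disjoint T U) : (L ++ L' ++ L'').Pairwise Disjoint := by
  refine List.pairwise_append.2 ⟨List.pairwise_append.2 ⟨hL, hL', fun P hP Q hQ =>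
    dST.mono (hS P hP) (hT Q hQ)⟩, hL'', fun P hP Q hQ => ?_⟩
  rcases List.mem_append.1 hP with hP | hP
  · exact dSU.mono (hS P hP) (hU Q hQ)
  · exact dTU.mono (hT P hP) (hU Q hQ)

namespace NewObs

variable {K X Y A₁ A₂ C₁ C₂ : Set V}

lemma false_of_O4 (hG : NewObs G) (hA : Tripod G A X A₁ A₂) (hC : Tripod G C Y C₁ C₂)
    (dAC : Disjoint A C) (dAK : Disjoint A K) (dCK : Disjoint C K) (hU : ConnSet G U)
    (hW : ConnSet G W) (dUW : Disjoint U W) (hUK : U ⊆ K) (hWK : W ⊆ K)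
    (tXU : Touch G X U) (tXW : Touch G X W) (tUW : Touch G U W) (tUY : Touch G U Y)
    (tWY : Touch G W Y) : False := by
  refine hG.not_minor (H := O4) (by simp [OList]) not_apexPseudoforest_O4
    (IsModel.isMinorOf (L := [A₁, A₂, X] ++ [U, W] ++ [Y, C₁, C₂]) ⟨?_, ?_, ?_⟩ rfl)
  · simp [hA.conn₁, hA.conn₂, hA.conn₃, hC.conn₁, hC.conn₂, hC.conn₃, hU, hW]
  · refine pairwise_disjoint_append (S := A) (T := K) (U := C) ?_ ?_ ?_ ?_ ?_ ?_ dAK dAC dCK.symm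
    · simp [hA.disj₂₃, hA.disj₁₂.symm, hA.disj₁₃.symm]
    · simp [dUW]
    · simp [hC.disj₂₃, hC.disj₁₂, hC.disj₁₃]
    · simp [hA.subset₁, hA.subset₂, hA.subset₃]
    · simp [hUK, hWK]
    · simp [hC.subset₁, hC.subset₂, hC.subset₃]
  · simp [hA.touch₂₃, hA.touch₁₂.symm, hA.touch₁₃.symm, hC.touch₁₂, hC.touch₁₃, hC.touch₂₃, tXU,
      tXW, tUW, tUY, tWY]

lemma false_of_O12 (hG : NewObs G) (hA : Tripod G A X A₁ A₂) (hC : Tripod G C Y C₁ C₂)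
    (hK : Tripod G K P Q R) (dAC : Disjoint A C) (dAK : Disjoint A K) (dCK : Disjoint C K)
    (tXY : Touch G X Y) (tXP : Touch G X P) (tYQ : Touch G Y Q) : False := by
  refine hG.not_minor (H := O12) (by simp [OList]) not_apexPseudoforest_O12
    (IsModel.isMinorOf (L := [A₁, A₂, X] ++ [Y, C₁, C₂] ++ [Q, P, R]) ⟨?_, ?_, ?_⟩ rfl)
  · simp [hA.conn₁, hA.conn₂, hA.conn₃, hC.conn₁, hC.conn₂, hC.conn₃, hK.conn₁, hK.conn₂, hK.conn₃]
  · refine pairwise_disjoint_append (S := A) (T := C) (U := K) ?_ ?_ ?_ ?_ ?_ ?_ dAC dAK dCK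
    · simp [hA.disj₂₃, hA.disj₁₂.symm, hA.disj₁₃.symm]
    · simp [hC.disj₂₃, hC.disj₁₂, hC.disj₁₃]
    · simp [hK.disj₂₃, hK.disj₁₂.symm, hK.disj₁₃]
    · simp [hA.subset₁, hA.subset₂, hA.subset₃]
    · simp [hC.subset₁, hC.subset₂, hC.subset₃]
    · simp [hK.subset₁, hK.subset₂, hK.subset₃]
  · simp [hA.touch₂₃, hA.touch₁₂.symm, hA.touch₁₃.symm, hC.touch₁₂, hC.touch₁₃, hC.touch₂₃,
      hK.touch₁₂.symm, hK.touch₁₃, hK.touch₂₃, tXY, tXP, tYQ]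

lemma false_of_O13 (hG : NewObs G) (hA : Tripod G A X A₁ A₂) (hC : Tripod G C Y C₁ C₂)
    (hK : Tripod G K P Q R) (dAC : Disjoint A C) (dAK : Disjoint A K) (dCK : Disjoint C K)
    (tXY : Touch G X Y) (tXP : Touch G X P) (tYP : Touch G Y P) : False := by
  refine hG.not_minor (H := O13) (by simp [OList]) not_apexPseudoforest_O13
    (IsModel.isMinorOf (L := [A₁, A₂, X] ++ [Y, C₁, C₂] ++ [Q, R, P]) ⟨?_, ?_, ?_⟩ rfl)
  · simp [hA.conn₁, hA.conn₂, hA.conn₃, hC.conn₁, hC.conn₂, hC.conn₃, hK.conn₁, hK.conn₂, hK.conn₃]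
  · refine pairwise_disjoint_append (S := A) (T := C) (U := K) ?_ ?_ ?_ ?_ ?_ ?_ dAC dAK dCK
    · simp [hA.disj₂₃, hA.disj₁₂.symm, hA.disj₁₃.symm]
    · simp [hC.disj₂₃, hC.disj₁₂, hC.disj₁₃]
    · simp [hK.disj₂₃, hK.disj₁₂.symm, hK.disj₁₃.symm]
    · simp [hA.subset₁, hA.subset₂, hA.subset₃]
    · simp [hC.subset₁, hC.subset₂, hC.subset₃]
    · simp [hK.subset₁, hK.subset₂, hK.subset₃]
  · simp [hA.touch₂₃, hA.touch₁₂.symm, hA.touch₁₃.symm, hC.touch₁₂, hC.touch₁₃, hC.touch₂₃,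
      hK.touch₁₂.symm, hK.touch₁₃.symm, hK.touch₂₃, tXY, tXP, tYP]

lemma false_of_O15 (hG : NewObs G) (hA : Tripod G A X A₁ A₂) (hC : Tripod G C Y C₁ C₂)
    (dAC : Disjoint A C) (dAK : Disjoint A K) (dCK : Disjoint C K) (hU : ConnSet G U)
    (hM : ConnSet G M) (hW : ConnSet G W) (dUM : Disjoint U M) (dUW : Disjoint U W)
    (dMW : Disjoint M W) (hUK : U ⊆ K) (hMK : M ⊆ K) (hWK : W ⊆ K) (tXY : Touch G X Y)
    (tXU : Touch G X U) (tXM : Touch G X M) (tUM : Touch G U M) (tMW : Touch G M W)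
    (tMY : Touch G M Y) (tWY : Touch G W Y) : False := by
  refine hG.not_minor (H := O15) (by simp [OList]) not_apexPseudoforest_O15
    (IsModel.isMinorOf (L := [A₁, A₂, X] ++ [U, M, W] ++ [Y, C₁, C₂]) ⟨?_, ?_, ?_⟩ rfl)
  · simp [hA.conn₁, hA.conn₂, hA.conn₃, hC.conn₁, hC.conn₂, hC.conn₃, hU, hM, hW]
  · refine pairwise_disjoint_append (S := A) (T := K) (U := C) ?_ ?_ ?_ ?_ ?_ ?_ dAK dAC dCK.symm
    · simp [hA.disj₂₃, hA.disj₁₂.symm, hA.disj₁₃.symm]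
    · simp [dUM, dUW, dMW]
    · simp [hC.disj₂₃, hC.disj₁₂, hC.disj₁₃]
    · simp [hA.subset₁, hA.subset₂, hA.subset₃]
    · simp [hUK, hMK, hWK]
    · simp [hC.subset₁, hC.subset₂, hC.subset₃]
  · simp [hA.touch₂₃, hA.touch₁₂.symm, hA.touch₁₃.symm, hC.touch₁₂, hC.touch₁₃, hC.touch₂₃, tXY,
      tXU, tXM, tUM, tMW, tMY, tWY]

end NewObs

lemma Tripod.extend (h : Tripod G S P Q R) {X : Set V} (hX : ConnSet G X) (hxX : x ∈ X)
    (hxP : x ∈ P) (hQ : Disjoint X Q) (hR : Disjoint X R) : Tripod G (X ∪ S) (X ∪ P) Q R :=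
  ⟨hX.union h.conn₁ ⟨x, hxX, hxP⟩, h.conn₂, h.conn₃, Set.disjoint_union_left.2 ⟨hQ, h.disj₁₂⟩,
    Set.disjoint_union_left.2 ⟨hR, h.disj₁₃⟩, h.disj₂₃,
    h.touch₁₂.mono Set.subset_union_right subset_rfl,
    h.touch₁₃.mono Set.subset_union_right subset_rfl, h.touch₂₃, by
      rw [← h.union]
      simp only [Set.union_assoc]⟩

/-! ### Separated cores -/

lemma exists_two_adj_of_hasCycle_insert {K : Set V} (h : HasCycle G (insert x K))
    (hK : ¬ HasCycle G K) : ∃ a ∈ K, ∃ b ∈ K, a ≠ b ∧ G.Adj x a ∧ G.Adj x b := by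
  obtain ⟨u, c, hc, hcK⟩ := h
  have hx : x ∈ c.support := by
    by_contra hx
    exact hK ⟨u, c, hc, fun w hw => (hcK w hw).resolve_left fun h => hx (h ▸ hw)⟩
  obtain ⟨a, ha, b, hb, hab, hxa, hxb⟩ := exists_two_adj_of_mem_cycle hc hx
  exact ⟨a, (hcK a ha).resolve_left hxa.ne.symm, b, (hcK b hb).resolve_left hxb.ne.symm, hab, hxa,
    hxb⟩

/-- The vertex `s` together with the vertices reachable in `K \ {s}` from the neighbours of `x`. -/
def hull (G : SimpleGraph V) (K : Set V) (s x : V) : Set V :=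
  {w | w = s ∨ ∃ n, G.Adj x n ∧ ReachIn G (K \ {s}) n w}

lemma connSet_hull {K : Set V} {s : V} (hK : ConnSet G K) (hs : s ∈ K) :
    ConnSet G (hull G K s x) := by
  refine connSet_of_forall (Or.inl rfl) ?_
  rintro w (rfl | ⟨n, hxn, hnw⟩)
  · exact .refl (Or.inl rfl)
  have hsub : comp G (K \ {s}) n ⊆ hull G K s x := fun z hz => Or.inr ⟨n, hxn, hz⟩
  have hn : n ∈ K \ {s} := hnw.left_mem
  obtain ⟨z, hz, t, rfl, hzt⟩ := touch_comp (hK.2 n hn.1 s hs) hn.2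
  exact (((connSet_comp hn).2 w hnw z hz).mono hsub).trans
    (.of_adj hzt (hsub hz) (Or.inl rfl))

lemma exists_split [Finite V] {K : Set V} {s : V} (hK : ConnSet G K) (hs : s ∈ K) (ha : a ∈ K)
    (hb : b ∈ K) (hab : a ≠ b) (hxa : G.Adj x a) (hxb : G.Adj x b) :
    ∃ M N, M ∪ N = hull G K s x ∧ ConnSet G M ∧ ConnSet G N ∧ Disjoint M N ∧ s ∈ M ∧
      Touch G M N ∧ Touch G {x} M ∧ Touch G {x} N := by
  have hmem : ∀ n ∈ K, G.Adj x n → n ∈ hull G K s x := by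
    intro n hn hxn
    by_cases hns : n = s
    · exact Or.inl hns
    · exact Or.inr ⟨n, hxn, .refl ⟨hn, hns⟩⟩
  obtain ⟨M, N, haM, hbN, hM, hN, hd, hun, ht⟩ := (connSet_hull (x := x) hK hs).exists_partition
    (connSet_singleton a) (connSet_singleton b) (Set.singleton_subset_iff.2 (hmem a ha hxa))
    (Set.singleton_subset_iff.2 (hmem b hb hxb)) (Set.disjoint_singleton.2 hab)
  have htM : Touch G {x} M := (touch_singletons hxa).mono subset_rfl haM
  have htN : Touch G {x} N := (touch_singletons hxb).mono subset_rfl hbN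
  have hsMN : s ∈ M ∪ N := hun ▸ Or.inl rfl
  rcases hsMN with hsM | hsN
  · exact ⟨M, N, hun, hM, hN, hd, hsM, ht, htM, htN⟩
  · exact ⟨N, M, by rw [Set.union_comm, hun], hN, hM, hd.symm, hsN, ht.symm, htN, htM⟩

lemma hull_subset {K : Set V} {s : V} (hs : s ∈ K) : hull G K s x ⊆ K := by
  rintro w (rfl | ⟨n, -, hnw⟩)
  · exact hs
  · exact hnw.right_mem.1

lemma NewObs.false_of_separated [Finite V] {K X Y A₁ A₂ C₁ C₂ : Set V} {s : V} (hG : NewObs G)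
    (hA : Tripod G A X A₁ A₂) (hC : Tripod G C Y C₁ C₂) (dAC : Disjoint A C) (dAK : Disjoint A K)
    (dCK : Disjoint C K) (tXY : Touch G X Y) (hxX : x ∈ X) (hyY : y ∈ Y) (hK : ConnSet G K)
    (tx : Touch G K {x}) (ty : Touch G K {y}) (cx : HasCycle G (insert x K))
    (cy : HasCycle G (insert y K)) (hs : s ∈ K) (hsep : hull G K s x ∩ hull G K s y ⊆ {s}) :
    False := by
  have hx : ({x} : Set V) ⊆ X := Set.singleton_subset_iff.2 hxX
  have hy : ({y} : Set V) ⊆ Y := Set.singleton_subset_iff.2 hyY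
  by_cases hcyc : HasCycle G K
  · obtain ⟨n, hn, _, rfl, hnx⟩ := tx
    obtain ⟨m, hm, _, rfl, hmy⟩ := ty
    obtain ⟨P, Q, R, hT, hnP⟩ := exists_tripod hK hn hcyc
    have tXP : Touch G X P := ⟨_, hxX, n, hnP, hnx.symm⟩
    rcases hT.mem hm with hmP | hmQ | hmR
    · exact hG.false_of_O13 hA hC hT dAC dAK dCK tXY tXP ⟨_, hyY, m, hmP, hmy.symm⟩
    · exact hG.false_of_O12 hA hC hT dAC dAK dCK tXY tXP ⟨_, hyY, m, hmQ, hmy.symm⟩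
    · exact hG.false_of_O12 hA hC hT.swap₂₃ dAC dAK dCK tXY tXP ⟨_, hyY, m, hmR, hmy.symm⟩
  · obtain ⟨a, ha, b, hb, hab, hxa, hxb⟩ := exists_two_adj_of_hasCycle_insert cx hcyc
    obtain ⟨a', ha', b', hb', hab', hya, hyb⟩ := exists_two_adj_of_hasCycle_insert cy hcyc
    obtain ⟨M, U, hMU, hM, hU, dMU, hsM, tMU, txM, txU⟩ := exists_split hK hs ha hb hab hxa hxb
    obtain ⟨N, W, hNW, hN, hW, dNW, hsN, tNW, tyN, tyW⟩ :=
      exists_split hK hs ha' hb' hab' hya hyb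
    have hKx := hull_subset (G := G) (x := x) hs
    have hKy := hull_subset (G := G) (x := y) hs
    rw [← hMU] at hsep hKx
    rw [← hNW] at hsep hKy
    have hsU : s ∉ U := Set.disjoint_left.1 dMU hsM
    have hsW : s ∉ W := Set.disjoint_left.1 dNW hsN
    have hdisj : ∀ w, (w ∈ M ∨ w ∈ U) → (w ∈ N ∨ w ∈ W) → w = s := fun w h h' => hsep ⟨h, h'⟩
    refine hG.false_of_O15 hA hC dAC dAK dCK hU (hM.union hN ⟨s, hsM, hsN⟩) hW ?_ ?_ ?_
      (Set.subset_union_right.trans hKx) (Set.union_subset (Set.subset_union_left.trans hKx)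
        (Set.subset_union_left.trans hKy)) (Set.subset_union_right.trans hKy) tXY
      (txU.mono hx subset_rfl) (txM.mono hx Set.subset_union_left)
      (tMU.symm.mono subset_rfl Set.subset_union_left)
      (tNW.mono Set.subset_union_right subset_rfl)
      (tyN.symm.mono Set.subset_union_right hy) (tyW.symm.mono subset_rfl hy)
    · rw [Set.disjoint_union_right]
      refine ⟨dMU.symm, Set.disjoint_left.2 fun w hw hw' => hsU ?_⟩
      exact hdisj w (Or.inr hw) (Or.inl hw') ▸ hw
    · refine Set.disjoint_left.2 fun w hw hw' => hsU ?_
      exact hdisj w (Or.inr hw) (Or.inr hw') ▸ hw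
    · rw [Set.disjoint_union_left]
      refine ⟨Set.disjoint_left.2 fun w hw hw' => hsW ?_, dNW⟩
      exact hdisj w (Or.inl hw) (Or.inr hw') ▸ hw'

/-! ### The middle part -/

variable {K : Set V} {s : V}

namespace Core

lemma symm (h : Core G A x C y K) : Core G C y A x K :=
  ⟨by rw [Set.union_comm, Set.sdiff_sdiff_comm]; exact h.subset, h.conn,
    by rw [Set.union_comm, Set.sdiff_sdiff_comm]; exact h.closed, h.touch₂, h.touch₁, h.cycle₂,
    h.cycle₁⟩

lemma disjoint_insert (h : Core G A x C y K) : Disjoint (insert x A) K := by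
  refine Set.disjoint_right.2 fun w hw hw' => ?_
  rcases hw' with rfl | hw'
  · exact (h.subset hw).1.2 rfl
  · exact (h.subset hw).1.1 (Or.inl hw')

lemma false_of_fanAt [Finite V] (hK : Core G A x C y K) (h : Dec G A x C y) (hG : NewObs G)
    (hfan : FanAt G (insert y K) {w | w ∈ K ∧ G.Adj x w} y) : False := by
  obtain ⟨U, W, hU, hW, hd, hUK, hWK, ⟨u, hu, -, hxu⟩, ⟨w, hw, -, hxw⟩, tU, tW⟩ := hfan
  obtain ⟨U', W', hUU, hWW, hU', hW', hd', hun, ht⟩ := hK.conn.exists_partition hU hW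
    (fun z hz => (hUK hz).1.resolve_left (hUK hz).2)
    (fun z hz => (hWK hz).1.resolve_left (hWK hz).2) hd
  obtain ⟨X, A₁, A₂, hA, hxX⟩ := exists_tripod h.connA (Or.inl rfl)
    (hG.hasCycle_insert h.attA h.xA h.nonemptyA)
  obtain ⟨Y, C₁, C₂, hC, hyY⟩ := exists_tripod h.connC (Or.inl rfl)
    (hG.hasCycle_insert h.attC h.yC h.nonemptyC)
  have hy : ({y} : Set V) ⊆ Y := Set.singleton_subset_iff.2 hyY
  exact hG.false_of_O4 hA hC h.disjoint_insert hK.disjoint_insert hK.symm.disjoint_insert hU' hW'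
    hd' (hun ▸ Set.subset_union_left) (hun ▸ Set.subset_union_right) ⟨x, hxX, u, hUU hu, hxu⟩
    ⟨x, hxX, w, hWW hw, hxw⟩ ht (tU.mono hUU hy) (tW.mono hWW hy)

lemma reachIn_diff (hK : Core G A x C y K) (h : Dec G A x C y) (hs : s ∈ K)
    (hr : ReachIn G ((A ∪ C)ᶜ \ {s}) x y)
    (hsep : ∀ n ∈ K, G.Adj x n → ¬ ReachIn G (insert y K \ {s}) n y) :
    ReachIn G ((A ∪ C)ᶜ \ K) x y := by
  have hxK : x ∉ K := fun hx => (hK.subset hx).1.2 rfl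
  have hyK : y ∉ K := fun hy => (hK.subset hy).2 rfl
  have hys : y ∈ insert y K \ {s} := ⟨Or.inl rfl, fun h => hyK (h ▸ hs)⟩
  by_contra hcon
  have := hr.invariant (P := fun w => ReachIn G ((A ∪ C)ᶜ \ K) x w ∨
    ∃ n, G.Adj x n ∧ ReachIn G (K \ {s}) n w) (Or.inl (.refl ⟨h.memB₁, hxK⟩)) ?_
  · rcases this with h | ⟨n, -, h⟩
    · exact hcon h
    · exact hyK h.right_mem.1
  rintro u v (hu | ⟨n, hxn, hnu⟩) huB huv hvB
  · by_cases hvK : v ∈ K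
    · have hux : u = x := by
        by_contra hux
        by_cases huy : u = y
        · exact hcon (huy ▸ hu)
        · exact hu.right_mem.2 (hK.closed v hvK u ⟨⟨huB.1, hux⟩, huy⟩ huv.symm)
      exact Or.inr ⟨v, hux ▸ huv, .refl ⟨hvK, hvB.2⟩⟩
    · exact Or.inl (hu.trans (.of_adj huv hu.right_mem ⟨hvB.1, hvK⟩))
  · by_cases hvx : v = x
    · subst hvx
      exact Or.inl (.refl ⟨h.memB₁, hxK⟩)
    have hnu' : ReachIn G (insert y K \ {s}) n u :=
      hnu.mono (Set.sdiff_subset_sdiff_left (Set.subset_insert y K))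
    by_cases hvy : v = y
    · subst hvy
      exact absurd (hnu'.trans (.of_adj huv hnu'.right_mem hys)) (hsep n hnu.left_mem.1 hxn)
    · have hvK := hK.closed u hnu.right_mem.1 v ⟨⟨hvB.1, hvx⟩, hvy⟩ huv
      exact Or.inr ⟨n, hxn, hnu.trans (.of_adj huv hnu.right_mem ⟨hvK, hvB.2⟩)⟩

lemma false_of_separated [Finite V] (hK : Core G A x C y K) (h : Dec G A x C y) (hG : NewObs G)
    (hs : s ∈ K) (hr : ReachIn G ((A ∪ C)ᶜ \ {s}) x y)
    (hsep : ∀ n ∈ K, G.Adj x n → ¬ ReachIn G (insert y K \ {s}) n y) : False := by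
  have hyK : y ∉ K := fun hy => (hK.subset hy).2 rfl
  have hr' := hK.reachIn_diff h hs hr hsep
  have hsub : comp G ((A ∪ C)ᶜ \ K) x ⊆ (A ∪ C)ᶜ \ K := comp_subset
  obtain ⟨X, Y, hxX, hyY, hX, hY, hXY, hun, ht⟩ := (connSet_comp hr'.left_mem).exists_partition
    (connSet_singleton x) (connSet_singleton y)
    (Set.singleton_subset_iff.2 (mem_comp_self hr'.left_mem)) (Set.singleton_subset_iff.2 hr')
    (Set.disjoint_singleton.2 h.ne)
  rw [Set.singleton_subset_iff] at hxX hyY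
  rw [← hun] at hsub
  have hXA : Disjoint X A := Set.disjoint_left.2 fun w hw hwA => (hsub (Or.inl hw)).1 (Or.inl hwA)
  have hXC : Disjoint X C := Set.disjoint_left.2 fun w hw hwC => (hsub (Or.inl hw)).1 (Or.inr hwC)
  have hYA : Disjoint Y A := Set.disjoint_left.2 fun w hw hwA => (hsub (Or.inr hw)).1 (Or.inl hwA)
  have hYC : Disjoint Y C := Set.disjoint_left.2 fun w hw hwC => (hsub (Or.inr hw)).1 (Or.inr hwC)
  have hXK : Disjoint X K := Set.disjoint_left.2 fun w hw hwK => (hsub (Or.inl hw)).2 hwK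
  have hYK : Disjoint Y K := Set.disjoint_left.2 fun w hw hwK => (hsub (Or.inr hw)).2 hwK
  have hyX : y ∉ X := Set.disjoint_right.1 hXY hyY
  have hxY : x ∉ Y := Set.disjoint_left.1 hXY hxX
  obtain ⟨P, A₁, A₂, hA, hxP⟩ := exists_tripod h.connA (Or.inl rfl)
    (hG.hasCycle_insert h.attA h.xA h.nonemptyA)
  obtain ⟨Q, C₁, C₂, hC, hyQ⟩ := exists_tripod h.connC (Or.inl rfl)
    (hG.hasCycle_insert h.attC h.yC h.nonemptyC)
  have avoid : ∀ {A P D X : Set V} {x : V}, D ⊆ insert x A → x ∈ P → Disjoint P D →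
      Disjoint X A → Disjoint X D := by
    intro A P D X x hD hx hd hXA
    refine Set.disjoint_left.2 fun w hw hwD => ?_
    rcases hD hwD with rfl | hwA
    · exact Set.disjoint_left.1 hd hx hwD
    · exact Set.disjoint_left.1 hXA hw hwA
  refine hG.false_of_separated
    (hA.extend hX hxX hxP (avoid hA.subset₂ hxP hA.disj₁₂ hXA)
      (avoid hA.subset₃ hxP hA.disj₁₃ hXA))
    (hC.extend hY hyY hyQ (avoid hC.subset₂ hyQ hC.disj₁₂ hYC)
      (avoid hC.subset₃ hyQ hC.disj₁₃ hYC)) ?_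
    (Set.disjoint_union_left.2 ⟨hXK, hK.disjoint_insert⟩)
    (Set.disjoint_union_left.2 ⟨hYK, hK.symm.disjoint_insert⟩)
    (ht.mono Set.subset_union_left Set.subset_union_left) (Or.inl hxX) (Or.inl hyY) hK.conn
    hK.touch₁ hK.touch₂ hK.cycle₁ hK.cycle₂ hs ?_
  · rw [Set.disjoint_union_left, Set.disjoint_union_right, Set.disjoint_union_right]
    exact ⟨⟨hXY, Set.disjoint_insert_right.2 ⟨hyX, hXC⟩⟩,
      Set.disjoint_insert_left.2 ⟨hxY, hYA.symm⟩, h.disjoint_insert⟩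
  · rintro w ⟨hw | ⟨n, hxn, hnw⟩, hw' | ⟨m, hym, hmw⟩⟩
    · exact hw
    · exact hw
    · exact hw'
    · have hr := (hnw.trans hmw.symm).mono
        (Set.sdiff_subset_sdiff_left (t := {s}) (Set.subset_insert y K))
      exact absurd (hr.trans (.of_adj hym.symm hr.right_mem
        ⟨Or.inl rfl, fun h => hyK (h ▸ hs)⟩)) (hsep n hnw.left_mem.1 hxn)

end Core

lemma Dec.false_of_minimal [Finite V] (h : Dec G A x C y) (hmin : Dec.Minimal G A C)
    (hG : NewObs G) : False := by
  obtain ⟨K, hK⟩ := h.exists_core hG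
  by_cases hsep : ∃ s ∈ K, ∀ n ∈ K, G.Adj x n → ¬ ReachIn G (insert y K \ {s}) n y
  · obtain ⟨s, hs, hsep⟩ := hsep
    obtain ⟨⟨hsB, hsx⟩, hsy⟩ := hK.subset hs
    exact hK.false_of_separated h hG hs (h.reachIn_of_minimal hmin hsB hsx hsy) hsep
  · push Not at hsep
    obtain ⟨n, hn, x', hx, hnx⟩ := hK.touch₁
    obtain ⟨m, hm, y', hy, hmy⟩ := hK.touch₂
    rw [Set.mem_singleton_iff.1 hx] at hnx
    rw [Set.mem_singleton_iff.1 hy] at hmy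
    have hyK : y ∉ K := fun hy => (hK.subset hy).2 rfl
    have hKy : K ⊆ insert y K := Set.subset_insert y K
    refine hK.false_of_fanAt h hG (exists_fanAt (fun hy => hyK hy.1) ⟨n, ⟨hn, hnx.symm⟩, ?_⟩ ?_)
    · exact ((hK.conn.2 n hn m hm).mono hKy).trans (.of_adj hmy (hKy hm) (Or.inl rfl))
    · intro w hw hwy
      obtain ⟨n, hn, hxn, hr⟩ := hsep w (hw.resolve_left hwy)
      exact ⟨n, ⟨hn, hxn⟩, hr⟩

end ApexPseudoforestObstruction

/-- Every obstruction for apex-pseudoforests not isomorphic to a member of `O`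
has at most one cut-vertex. -/
theorem obstruction_at_most_one_cutVertex {V : Type} [Finite V] (G : SimpleGraph V)
    (h1 : ObsApexPseudoforest G) (h2 : ¬ InO G) :
    {x : V | CutVertex G x}.Subsingleton := by
  intro x hx y hy
  by_contra hxy
  have hG : ApexPseudoforestObstruction.NewObs G := ⟨h1, h2⟩
  obtain ⟨A, C, h⟩ := ApexPseudoforestObstruction.exists_dec hG.connSet_univ hx hy hxy
  obtain ⟨A, x, C, y, h, hmin⟩ := h.exists_minimal
  exact h.false_of_minimal hmin hG
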